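/- arXiv:2508.17277 — 2 statements merged into one kernel-verified Lean document; each statement's English description precedes it below -/
import Mathlib

section
/- There is an absolute constant c > 0 such that for every n-element point set P in the plane in general position and every ε > 0, there exists a finite set L of at most c/ε² lines such that for every line ℓ ∉ L, the zone of ℓ within the arrangement A(L) contains at most ε·n points of P. -/
open scoped Classical

/-- Points in the plane. -/
abbrev Pt := ℝ × ℝ

/-- A finite planar point set is in general position if no three of its points are collinear. -/
def GenPos (P : Finset Pt) : Prop :=
  ∀ p ∈ P, ∀ q ∈ P, ∀ r ∈ P, p ≠ q → p ≠ r → q ≠ r → ¬ Collinear ℝ ({p, q, r} : Set Pt)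

/-- Two closed segments cross: their intersection is a single point lying in the
relative interior (open segment) of both. -/
def SegCross (s t : Pt × Pt) : Prop :=
  ∃ x : Pt, segment ℝ s.1 s.2 ∩ segment ℝ t.1 t.2 = {x} ∧
    x ∈ openSegment ℝ s.1 s.2 ∧ x ∈ openSegment ℝ t.1 t.2

/-- A crossing family of size `k` in `P`: `k` segments with endpoints in `P`, pairwise crossing. -/
def CrossingFamily (P : Finset Pt) (k : ℕ) : Prop :=
  ∃ F : Finset (Pt × Pt), F.card = k ∧ (∀ e ∈ F, e.1 ∈ P ∧ e.2 ∈ P) ∧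
    ∀ e ∈ F, ∀ f ∈ F, e ≠ f → SegCross e f

/-- A non-crossing family of size `m` in `P`. -/
def NonCrossingFamily (P : Finset Pt) (m : ℕ) : Prop :=
  ∃ P₁ P₂ P₃ P₄ : Finset Pt,
    P₁ ⊆ P ∧ P₂ ⊆ P ∧ P₃ ⊆ P ∧ P₄ ⊆ P ∧
    Disjoint P₁ P₂ ∧ Disjoint P₁ P₃ ∧ Disjoint P₁ P₄ ∧
    Disjoint P₂ P₃ ∧ Disjoint P₂ P₄ ∧ Disjoint P₃ P₄ ∧
    m ≤ P₁.card ∧ m ≤ P₂.card ∧ m ≤ P₃.card ∧ m ≤ P₄.card ∧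
    ∀ p₁ ∈ P₁, ∀ p₂ ∈ P₂, ∀ p₃ ∈ P₃, ∀ p₄ ∈ P₄,
      p₄ ∈ interior (convexHull ℝ ({p₁, p₂, p₃} : Set Pt))

/-- A point set is in convex position if no point lies in the convex hull of the others. -/
def ConvexPos (S : Set Pt) : Prop := ∀ p ∈ S, p ∉ convexHull ℝ (S \ {p})

/-- A convex bundle of size `k` and width `m` in `P`. -/
def ConvexBundle (P : Finset Pt) (k m : ℕ) : Prop :=
  ∃ C : Fin k → Finset Pt, (∀ i, C i ⊆ P) ∧
    (∀ i j, i ≠ j → Disjoint (C i) (C j)) ∧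
    (∀ i, m ≤ (C i).card) ∧
    ∀ f : Fin k → Pt, (∀ i, f i ∈ C i) → ConvexPos (Set.range f)

/-- Two finite point sets are separated if their convex hulls are disjoint. -/
def Separated (A B : Finset Pt) : Prop :=
  Disjoint (convexHull ℝ (A : Set Pt)) (convexHull ℝ (B : Set Pt))

/-- A line in the plane, given by an equation `a * x + b * y = c` with `(a, b) ≠ (0, 0)`. -/
structure Line where
  a : ℝ
  b : ℝ
  c : ℝ
  nondeg : a ≠ 0 ∨ b ≠ 0

/-- The set of points of a line. -/
def Line.toSet (L : Line) : Set Pt := {x | L.a * x.1 + L.b * x.2 = L.c}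

/-- Two lines are parallel if their normal vectors are proportional. -/
def Line.Parallel (L M : Line) : Prop := L.a * M.b - L.b * M.a = 0

/-- A spoke set of size `k` in `P`: `k` pairwise non-parallel lines such that every unbounded
cell of their arrangement (unbounded connected component of the complement of their union)
contains a point of `P`. -/
def SpokeSet (P : Finset Pt) (k : ℕ) : Prop :=
  ∃ ℓ : Fin k → Line,
    (∀ i j, i ≠ j → ¬ (ℓ i).Parallel (ℓ j)) ∧
    ∀ x : Pt, x ∈ (⋃ i, (ℓ i).toSet)ᶜ →
      ¬ Bornology.IsBounded (connectedComponentIn (⋃ i, (ℓ i).toSet)ᶜ x) →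
      ∃ p ∈ P, p ∈ connectedComponentIn (⋃ i, (ℓ i).toSet)ᶜ x

/-- `b` lies strictly to the left of the line through `x` and `y`, oriented from `x` to `y`. -/
def LeftOf (x y b : Pt) : Prop :=
  0 < (y.1 - x.1) * (b.2 - x.2) - (y.2 - x.2) * (b.1 - x.1)

/-- The relation `<_B`: `x <_B y` iff `B` is contained in the open half-plane to the left of
the line through `x` and `y` oriented from `x` towards `y`. -/
def LtRel (B : Finset Pt) (x y : Pt) : Prop :=
  x ≠ y ∧ ∀ b ∈ B, LeftOf x y b

/-- `x` and `y` are incomparable in `<_B`. -/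
def Incomp (B : Finset Pt) (x y : Pt) : Prop := ¬ LtRel B x y ∧ ¬ LtRel B y x

/-- `ι(A, <_B)`: the number of unordered pairs of distinct points of `A`
that are incomparable in `<_B`. -/
noncomputable def iota (A B : Finset Pt) : ℕ :=
  Set.ncard {s : Finset Pt | ∃ x y : Pt, x ≠ y ∧ s = {x, y} ∧ x ∈ A ∧ y ∈ A ∧ Incomp B x y}

/-- `A` and `B` (two `m`-element sets) form an `ε`-avoiding pair. -/
def EpsAvoiding (ε : ℝ) (m : ℕ) (A B : Finset Pt) : Prop :=
  ((iota A B : ℝ) + (iota B A : ℝ)) ≤ ε * (m : ℝ) ^ 2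

/-- The zone of a line `ℓ` in the arrangement of the lines `ℓs`: the union of all cells
(connected components of the complement) whose closure meets `ℓ`. -/
noncomputable def Zone (r : ℕ) (ℓs : Fin r → Line) (ℓ : Line) : Set Pt :=
  {y | ∃ x ∈ (⋃ i, (ℓs i).toSet)ᶜ,
    y ∈ connectedComponentIn (⋃ i, (ℓs i).toSet)ᶜ x ∧
    (closure (connectedComponentIn (⋃ i, (ℓs i).toSet)ᶜ x) ∩ ℓ.toSet).Nonempty}

/-! ### Trapezoids -/

/-- A non-vertical line `y = m x + k` given as `(m, k)`. -/
abbrev Ln := ℝ × ℝ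

/-- Height of the line at abscissa `x`. -/
def ev (h : Ln) (x : ℝ) : ℝ := h.1 * x + h.2

structure Trap where
  u : Ln
  d : Ln
  a : ℝ
  b : ℝ

def Trap.Crosses (τ : Trap) (h : Ln) : Prop :=
  ∃ x, τ.a < x ∧ x < τ.b ∧ ev τ.d x < ev h x ∧ ev h x < ev τ.u x

/-- order of lines just to the right of `x` -/
def KeyLt (x : ℝ) (s s' : Ln) : Prop :=
  ev s x < ev s' x ∨ (ev s x = ev s' x ∧ s.1 < s'.1)

structure IsTrap (X : ℝ) (S : Finset Ln) (p : Pt) (τ : Trap) : Prop where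
  uS : τ.u ∈ S
  dS : τ.d ∈ S
  pu : p.2 < ev τ.u p.1
  pd : ev τ.d p.1 < p.2
  umin : ∀ s ∈ S, p.2 < ev s p.1 → ¬ KeyLt p.1 s τ.u
  dmax : ∀ s ∈ S, ev s p.1 < p.2 → ¬ KeyLt p.1 τ.d s
  ap : τ.a ≤ p.1
  pb : p.1 < τ.b
  Xa : -X ≤ τ.a
  bX : τ.b ≤ X
  ha : τ.a = -X ∨ (∃ s ∈ S, s.1 ≠ τ.u.1 ∧ ev s τ.a = ev τ.u τ.a) ∨
    (∃ s ∈ S, s.1 ≠ τ.d.1 ∧ ev s τ.a = ev τ.d τ.a)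
  hb : τ.b = X ∨ (∃ s ∈ S, s.1 ≠ τ.u.1 ∧ ev s τ.b = ev τ.u τ.b) ∨
    (∃ s ∈ S, s.1 ≠ τ.d.1 ∧ ev s τ.b = ev τ.d τ.b)
  hvu : ∀ s ∈ S, ∀ x, τ.a < x → x < τ.b → ev s x = ev τ.u x → s.1 = τ.u.1
  hvd : ∀ s ∈ S, ∀ x, τ.a < x → x < τ.b → ev s x = ev τ.d x → s.1 = τ.d.1

lemma ev_eq_of_two {s t : Ln} {x y : ℝ} (hxy : x ≠ y) (h1 : ev s x = ev t x)
    (h2 : ev s y = ev t y) : s = t := by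
  simp only [ev] at h1 h2
  have h3 : (s.1 - t.1) * (x - y) = 0 := by linarith
  have h4 : s.1 = t.1 := by
    rcases mul_eq_zero.mp h3 with h | h
    · linarith
    · exact absurd (by linarith) hxy
  have h5 : s.2 = t.2 := by rw [h4] at h1; linarith
  exact Prod.ext h4 h5

lemma keyLt_tri {x : ℝ} {s t : Ln} (h1 : ¬ KeyLt x s t) (h2 : ¬ KeyLt x t s) : s = t := by
  simp only [KeyLt, not_or, not_and, not_lt] at h1 h2
  have h3 : ev s x = ev t x := le_antisymm h2.1 h1.1
  have h4 : s.1 = t.1 := le_antisymm (h2.2 h3.symm) (h1.2 h3)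
  refine Prod.ext h4 ?_
  simp only [ev] at h3
  rw [h4] at h3; linarith

/-- two lines not meeting transversally in `(a,b)`: order at one point gives order everywhere -/
lemma lt_of_noMeet {s t : Ln} {a b x y : ℝ}
    (hn : ∀ x, a < x → x < b → ev s x = ev t x → s.1 = t.1)
    (hx : a < x) (hx' : x < b) (hy : a < y) (hy' : y < b) (h : ev s x < ev t x) :
    ev s y < ev t y := by
  by_contra hc
  push Not at hc
  by_cases hm : s.1 = t.1
  · simp only [ev] at h hc
    rw [hm] at h hc; linarith
  · have hm' : s.1 - t.1 ≠ 0 := sub_ne_zero.mpr hm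
    set z := (t.2 - s.2) / (s.1 - t.1) with hz
    have hz1 : (s.1 - t.1) * z = t.2 - s.2 := by rw [hz]; field_simp
    have hz2 : ev s z = ev t z := by simp only [ev]; linarith
    simp only [ev] at h hc
    have e1 : (s.1 - t.1) * (x - z) < 0 := by linarith
    have e2 : 0 ≤ (s.1 - t.1) * (y - z) := by linarith
    apply hm
    apply hn z _ _ hz2
    · by_contra hza
      push Not at hza
      have : 0 < x - z := by linarith
      have : 0 < y - z := by linarith
      rcases lt_or_gt_of_ne hm' with h' | h' <;> nlinarith
    · by_contra hza
      push Not at hza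
      have : x - z < 0 := by linarith
      have : y - z < 0 := by linarith
      rcases lt_or_gt_of_ne hm' with h' | h' <;> nlinarith

lemma keyLt_of_lt {s t : Ln} {a b x p : ℝ}
    (hn : ∀ x, a < x → x < b → ev s x = ev t x → s.1 = t.1)
    (hx : a < x) (hx' : x < b) (hp : a ≤ p) (hp' : p < b) (h : ev s x < ev t x) :
    KeyLt p s t := by
  rcases hp.lt_or_eq with hp | rfl
  · exact Or.inl (lt_of_noMeet hn hx hx' hp hp' h)
  · by_contra hc
    simp only [KeyLt, not_or, not_and, not_lt] at hc
    rcases hc.1.lt_or_eq with h1 | h1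
    · -- strictly above at a, so crossing inside
      simp only [ev] at h h1
      have hm : (s.1 - t.1) ≠ 0 := by
        intro h0
        have : s.1 = t.1 := by linarith
        rw [this] at h h1; linarith
      set z := (t.2 - s.2) / (s.1 - t.1) with hz
      have hz1 : (s.1 - t.1) * z = t.2 - s.2 := by rw [hz]; field_simp
      have hz2 : ev s z = ev t z := by simp only [ev]; linarith
      have e1 : (s.1 - t.1) * (x - z) < 0 := by linarith
      have e2 : 0 < (s.1 - t.1) * (a - z) := by linarith
      have hneg : s.1 - t.1 < 0 := by
        by_contra hcc
        push Not at hcc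
        have : 0 < s.1 - t.1 := lt_of_le_of_ne hcc (Ne.symm hm)
        nlinarith
      apply hm
      have := hn z (by nlinarith) (by nlinarith) hz2
      linarith
    · have := hc.2 h1.symm
      simp only [ev] at h h1
      nlinarith

namespace IsTrap

variable {X : ℝ} {S : Finset Ln} {p : Pt} {τ : Trap}

lemma d_lt_u (h : IsTrap X S p τ) {x : ℝ} (hx : τ.a < x) (hx' : x < τ.b) :
    ev τ.d x < ev τ.u x := by
  by_contra hc
  push Not at hc
  have hpp : ev τ.d p.1 < ev τ.u p.1 := h.pd.trans h.pu
  rcases hc.lt_or_eq with hc | hc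
  · rcases keyLt_of_lt (h.hvd _ h.uS) hx hx' h.ap h.pb hc with h1 | h1
    · linarith
    · linarith [h1.1]
  · have hm := h.hvd _ h.uS x hx hx' hc
    simp only [ev] at hc hpp
    rw [hm] at hc hpp; linarith

lemma not_crosses (h : IsTrap X S p τ) (hoff : ∀ s ∈ S, ev s p.1 ≠ p.2) {s : Ln} (hs : s ∈ S) :
    ¬ τ.Crosses s := by
  rintro ⟨x, hx, hx', h1, h2⟩
  have k1 := keyLt_of_lt (h.hvu _ hs) hx hx' h.ap h.pb h2
  have k2 := keyLt_of_lt (fun y hy hy' e => (h.hvd _ hs y hy hy' e.symm).symm) hx hx' h.ap h.pb h1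
  rcases lt_or_gt_of_ne (hoff s hs) with h3 | h3
  · exact h.dmax s hs h3 k2
  · exact h.umin s hs h3 k1

lemma a_le {q : Pt} {τ' : Trap} (h : IsTrap X S p τ) (h' : IsTrap X S q τ')
    (hu : τ.u = τ'.u) (hd : τ.d = τ'.d) (hb : τ'.a < τ.b) : τ'.a ≤ τ.a := by
  by_contra hc
  push Not at hc
  rcases h'.ha with e | ⟨s, hs, e1, e2⟩ | ⟨s, hs, e1, e2⟩
  · have := h.Xa; linarith
  · rw [← hu] at e1 e2
    exact e1 (h.hvu s hs _ hc hb e2)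
  · rw [← hd] at e1 e2
    exact e1 (h.hvd s hs _ hc hb e2)

lemma b_le {q : Pt} {τ' : Trap} (h : IsTrap X S p τ) (h' : IsTrap X S q τ')
    (hu : τ.u = τ'.u) (hd : τ.d = τ'.d) (hb : τ.a < τ'.b) : τ.b ≤ τ'.b := by
  by_contra hc
  push Not at hc
  rcases h'.hb with e | ⟨s, hs, e1, e2⟩ | ⟨s, hs, e1, e2⟩
  · have := h.bX; linarith
  · rw [← hu] at e1 e2
    exact e1 (h.hvu s hs _ hb hc e2)
  · rw [← hd] at e1 e2
    exact e1 (h.hvd s hs _ hb hc e2)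

lemma unique {τ' : Trap} (h : IsTrap X S p τ) (h' : IsTrap X S p τ') : τ = τ' := by
  have hu : τ.u = τ'.u := keyLt_tri (h'.umin _ h.uS h.pu) (h.umin _ h'.uS h'.pu)
  have hd : τ.d = τ'.d := keyLt_tri (h.dmax _ h'.dS h'.pd) (h'.dmax _ h.dS h.pd)
  have ha : τ.a = τ'.a := le_antisymm
    (a_le h' h hu.symm hd.symm (h.ap.trans_lt h'.pb))
    (a_le h h' hu hd (h'.ap.trans_lt h.pb))
  have hb : τ.b = τ'.b := le_antisymm (b_le h h' hu hd (h.ap.trans_lt h'.pb))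
    (b_le h' h hu.symm hd.symm (h'.ap.trans_lt h.pb))
  cases τ; cases τ'; simp_all

/-- Restriction to a subset containing four defining lines. -/
lemma defining (h : IsTrap X S p τ) : ∃ D : Finset Ln, D ⊆ S ∧ D.card ≤ 4 ∧
    ∀ S' : Finset Ln, D ⊆ S' → S' ⊆ S → IsTrap X S' p τ := by
  have hA : ∃ sa ∈ S, τ.a = -X ∨ (sa.1 ≠ τ.u.1 ∧ ev sa τ.a = ev τ.u τ.a) ∨
    (sa.1 ≠ τ.d.1 ∧ ev sa τ.a = ev τ.d τ.a) := by
    rcases h.ha with e | ⟨s, hs, e⟩ | ⟨s, hs, e⟩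
    · exact ⟨τ.u, h.uS, Or.inl e⟩
    · exact ⟨s, hs, Or.inr (Or.inl e)⟩
    · exact ⟨s, hs, Or.inr (Or.inr e)⟩
  have hB : ∃ sa ∈ S, τ.b = X ∨ (sa.1 ≠ τ.u.1 ∧ ev sa τ.b = ev τ.u τ.b) ∨
    (sa.1 ≠ τ.d.1 ∧ ev sa τ.b = ev τ.d τ.b) := by
    rcases h.hb with e | ⟨s, hs, e⟩ | ⟨s, hs, e⟩
    · exact ⟨τ.u, h.uS, Or.inl e⟩
    · exact ⟨s, hs, Or.inr (Or.inl e)⟩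
    · exact ⟨s, hs, Or.inr (Or.inr e)⟩
  obtain ⟨sa, hsa, ea⟩ := hA
  obtain ⟨sb, hsb, eb⟩ := hB
  refine ⟨{τ.u, τ.d, sa, sb}, ?_, Finset.card_le_four, ?_⟩
  · intro s hs
    simp only [Finset.mem_insert, Finset.mem_singleton] at hs
    rcases hs with rfl | rfl | rfl | rfl
    exacts [h.uS, h.dS, hsa, hsb]
  · intro S' hD hS'
    have hsa' : sa ∈ S' := hD (by simp)
    have hsb' : sb ∈ S' := hD (by simp)
    exact
    { uS := hD (by simp)
      dS := hD (by simp)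
      pu := h.pu
      pd := h.pd
      umin := fun s hs => h.umin s (hS' hs)
      dmax := fun s hs => h.dmax s (hS' hs)
      ap := h.ap
      pb := h.pb
      Xa := h.Xa
      bX := h.bX
      ha := by
        rcases ea with e | e | e
        · exact Or.inl e
        · exact Or.inr (Or.inl ⟨sa, hsa', e⟩)
        · exact Or.inr (Or.inr ⟨sa, hsa', e⟩)
      hb := by
        rcases eb with e | e | e
        · exact Or.inl e
        · exact Or.inr (Or.inl ⟨sb, hsb', e⟩)
        · exact Or.inr (Or.inr ⟨sb, hsb', e⟩)
      hvu := fun s hs => h.hvu s (hS' hs)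
      hvd := fun s hs => h.hvd s (hS' hs) }

lemma eq_of_u_a {q : Pt} {τ' : Trap} (h : IsTrap X S p τ) (h' : IsTrap X S q τ')
    (hoff : ∀ s ∈ S, ev s p.1 ≠ p.2) (hoff' : ∀ s ∈ S, ev s q.1 ≠ q.2)
    (hu : τ.u = τ'.u) (ha : τ.a = τ'.a) : τ = τ' := by
  have hab : τ.a < τ.b := h.ap.trans_lt h.pb
  have hab' : τ'.a < τ'.b := h'.ap.trans_lt h'.pb
  have key : ∀ x, τ.a < x → x < τ.b → x < τ'.b → ev τ.d x = ev τ'.d x := by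
    intro x h1 h2 h3
    have e1 := h.not_crosses hoff h'.dS
    have e2 := h'.not_crosses hoff' h.dS
    have e3 := h.d_lt_u h1 h2
    have e4 := h'.d_lt_u (ha ▸ h1) h3
    refine le_antisymm ?_ ?_
    · by_contra hc
      exact e2 ⟨x, ha ▸ h1, h3, not_le.mp hc, hu ▸ e3⟩
    · by_contra hc
      exact e1 ⟨x, h1, h2, not_le.mp hc, hu ▸ e4⟩
  obtain ⟨x, hx1, hx2⟩ := exists_between (lt_min hab (ha ▸ hab' : τ.a < τ'.b))
  obtain ⟨y, hy1, hy2⟩ := exists_between hx1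
  have hd : τ.d = τ'.d := by
    refine ev_eq_of_two hy2.ne (key y hy1 ?_ ?_) (key x hx1 ?_ ?_)
    all_goals have := lt_min_iff.mp hx2
    all_goals linarith [this.1, this.2]
  have hb : τ.b = τ'.b := le_antisymm (b_le h h' hu hd (ha ▸ hab'))
    (b_le h' h hu.symm hd.symm (ha ▸ hab))
  cases τ; cases τ'; simp_all

lemma eq_of_d_a {q : Pt} {τ' : Trap} (h : IsTrap X S p τ) (h' : IsTrap X S q τ')
    (hoff : ∀ s ∈ S, ev s p.1 ≠ p.2) (hoff' : ∀ s ∈ S, ev s q.1 ≠ q.2)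
    (hd : τ.d = τ'.d) (ha : τ.a = τ'.a) : τ = τ' := by
  have hab : τ.a < τ.b := h.ap.trans_lt h.pb
  have hab' : τ'.a < τ'.b := h'.ap.trans_lt h'.pb
  have key : ∀ x, τ.a < x → x < τ.b → x < τ'.b → ev τ.u x = ev τ'.u x := by
    intro x h1 h2 h3
    have e1 := h.not_crosses hoff h'.uS
    have e2 := h'.not_crosses hoff' h.uS
    have e3 := h.d_lt_u h1 h2
    have e4 := h'.d_lt_u (ha ▸ h1) h3
    refine le_antisymm ?_ ?_
    · by_contra hc
      exact e1 ⟨x, h1, h2, hd ▸ e4, not_le.mp hc⟩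
    · by_contra hc
      exact e2 ⟨x, ha ▸ h1, h3, hd ▸ e3, not_le.mp hc⟩
  obtain ⟨x, hx1, hx2⟩ := exists_between (lt_min hab (ha ▸ hab' : τ.a < τ'.b))
  obtain ⟨y, hy1, hy2⟩ := exists_between hx1
  have hu : τ.u = τ'.u := by
    refine ev_eq_of_two hy2.ne (key y hy1 ?_ ?_) (key x hx1 ?_ ?_)
    all_goals have := lt_min_iff.mp hx2
    all_goals linarith [this.1, this.2]
  exact h.eq_of_u_a h' hoff hoff' hu ha

end IsTrap

/-- abscissa of the intersection of two lines -/
noncomputable def vx (s t : Ln) : ℝ := (t.2 - s.2) / (s.1 - t.1)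

lemma ev_vx {s t : Ln} (h : s.1 ≠ t.1) : ev s (vx s t) = ev t (vx s t) := by
  have hm' : s.1 - t.1 ≠ 0 := sub_ne_zero.mpr h
  have hz1 : (s.1 - t.1) * vx s t = t.2 - s.2 := by rw [vx]; field_simp
  simp only [ev]; linarith

lemma eq_vx {s t : Ln} (h : s.1 ≠ t.1) {x : ℝ} (hx : ev s x = ev t x) : x = vx s t := by
  have hm' : s.1 - t.1 ≠ 0 := sub_ne_zero.mpr h
  rw [vx, eq_div_iff hm']
  simp only [ev] at hx; linarith

lemma exists_isTrap {X : ℝ} {S : Finset Ln} {p : Pt} (hX1 : -X ≤ p.1) (hX2 : p.1 < X)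
    (hup : ∃ s ∈ S, p.2 < ev s p.1) (hdn : ∃ s ∈ S, ev s p.1 < p.2) :
    ∃ τ, IsTrap X S p τ := by
  have keyeq : ∀ s t : Ln, KeyLt p.1 s t ↔
      (toLex (ev s p.1, s.1) : ℝ ×ₗ ℝ) < toLex (ev t p.1, t.1) := by
    intro s t
    rw [Prod.Lex.toLex_lt_toLex]; rfl
  obtain ⟨u, hu, humin⟩ := Finset.exists_min_image (S.filter fun s => p.2 < ev s p.1)
    (fun s => (toLex (ev s p.1, s.1) : ℝ ×ₗ ℝ))
    (by obtain ⟨s, h1, h2⟩ := hup; exact ⟨s, by simp [h1, h2]⟩)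
  obtain ⟨d, hd, hdmax⟩ := Finset.exists_max_image (S.filter fun s => ev s p.1 < p.2)
    (fun s => (toLex (ev s p.1, s.1) : ℝ ×ₗ ℝ))
    (by obtain ⟨s, h1, h2⟩ := hdn; exact ⟨s, by simp [h1, h2]⟩)
  rw [Finset.mem_filter] at hu hd
  set V : Finset ℝ := ((S.filter fun s => s.1 ≠ u.1).image fun s => vx s u) ∪
    ((S.filter fun s => s.1 ≠ d.1).image fun s => vx s d) with hV
  have hVmem : ∀ x ∈ V, (∃ s ∈ S, s.1 ≠ u.1 ∧ ev s x = ev u x) ∨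
      (∃ s ∈ S, s.1 ≠ d.1 ∧ ev s x = ev d x) := by
    intro x hx
    simp only [hV, Finset.mem_union, Finset.mem_image, Finset.mem_filter] at hx
    rcases hx with ⟨s, ⟨h1, h2⟩, rfl⟩ | ⟨s, ⟨h1, h2⟩, rfl⟩
    · exact Or.inl ⟨s, h1, h2, ev_vx h2⟩
    · exact Or.inr ⟨s, h1, h2, ev_vx h2⟩
  have hVu : ∀ s ∈ S, ∀ x, s.1 ≠ u.1 → ev s x = ev u x → x ∈ V := by
    intro s hs x h1 h2
    simp only [hV, Finset.mem_union, Finset.mem_image, Finset.mem_filter]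
    exact Or.inl ⟨s, ⟨hs, h1⟩, (eq_vx h1 h2).symm⟩
  have hVd : ∀ s ∈ S, ∀ x, s.1 ≠ d.1 → ev s x = ev d x → x ∈ V := by
    intro s hs x h1 h2
    simp only [hV, Finset.mem_union, Finset.mem_image, Finset.mem_filter]
    exact Or.inr ⟨s, ⟨hs, h1⟩, (eq_vx h1 h2).symm⟩
  obtain ⟨a, ha, hamax⟩ := Finset.exists_max_image
    (insert (-X) (V.filter fun x => -X ≤ x ∧ x ≤ p.1)) id ⟨-X, by simp⟩
  obtain ⟨b, hb, hbmin⟩ := Finset.exists_min_image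
    (insert X (V.filter fun x => p.1 < x ∧ x ≤ X)) id ⟨X, by simp⟩
  simp only [Finset.mem_insert, Finset.mem_filter, id] at ha hamax hb hbmin
  have hXa : -X ≤ a := hamax _ (Or.inl rfl)
  have hbX : b ≤ X := hbmin _ (Or.inl rfl)
  have hap : a ≤ p.1 := by rcases ha with rfl | ha; exacts [hX1, ha.2.2]
  have hpb : p.1 < b := by rcases hb with rfl | hb; exacts [hX2, hb.2.1]
  have hVab : ∀ x ∈ V, a < x → x < b → False := by
    intro x hx h1 h2
    rcases le_or_gt x p.1 with h3 | h3
    · exact absurd (hamax x (Or.inr ⟨hx, by linarith, h3⟩)) (not_le.mpr h1)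
    · exact absurd (hbmin x (Or.inr ⟨hx, h3, by linarith⟩)) (not_le.mpr h2)
  refine ⟨⟨u, d, a, b⟩, ?_⟩
  exact
  { uS := hu.1
    dS := hd.1
    pu := hu.2
    pd := hd.2
    umin := fun s hs h => by
      rw [keyeq, not_lt]; exact humin s (by simp [hs, h])
    dmax := fun s hs h => by
      rw [keyeq, not_lt]; exact hdmax s (by simp [hs, h])
    ap := hap
    pb := hpb
    Xa := hXa
    bX := hbX
    ha := by
      rcases ha with h | h
      · exact Or.inl h
      · exact Or.inr (hVmem a h.1)
    hb := by
      rcases hb with h | h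
      · exact Or.inl h
      · exact Or.inr (hVmem b h.1)
    hvu := fun s hs x h1 h2 h3 => by
      by_contra hc
      exact hVab x (hVu s hs x hc h3) h1 h2
    hvd := fun s hs x h1 h2 h3 => by
      by_contra hc
      exact hVab x (hVd s hs x hc h3) h1 h2 }

/-! ### Random sampling (backwards analysis) -/

lemma backwards {α : Type*} [Fintype α] [DecidableEq α] (w : α → ℝ) (hw : ∀ a, 0 < w a)
    (t : ℕ) (G : Finset α → α → Prop)
    (hG : ∀ f : Fin (t + 1) → α,
      (Finset.univ.filter fun i => G ((Finset.univ.erase i).image f) (f i)).card ≤ 4) :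
    ∑ g : Fin t → α, (∏ j, w (g j)) * ∑ a, (if G (Finset.univ.image g) a then w a else 0)
      ≤ 4 * (∑ a, w a) ^ (t + 1) / (t + 1) := by
  set F : Fin (t + 1) → ℝ := fun i => ∑ f : Fin (t + 1) → α,
    (∏ j, w (f j)) * (if G ((Finset.univ.erase i).image f) (f i) then 1 else 0) with hF
  have hsym : ∀ i, F i = F 0 := by
    intro i
    simp only [hF]
    refine Fintype.sum_equiv ((Equiv.swap 0 i).arrowCongr (Equiv.refl α)) _ _ ?_
    intro f
    have h1 : ∏ j, w (((Equiv.swap 0 i).arrowCongr (Equiv.refl α)) f j) = ∏ j, w (f j) := by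
      simp only [Equiv.arrowCongr_apply, Equiv.coe_refl, Function.comp_apply, id]
      exact Equiv.prod_comp (Equiv.swap 0 i).symm (fun j => w (f j))
    have h2 : (Finset.univ.erase (0 : Fin (t+1))).image
        (((Equiv.swap 0 i).arrowCongr (Equiv.refl α)) f) = (Finset.univ.erase i).image f := by
      ext a
      simp only [Finset.mem_image, Finset.mem_erase, Finset.mem_univ, and_true,
        Equiv.arrowCongr_apply, Equiv.coe_refl, Function.comp_apply, id, Equiv.symm_swap]
      constructor
      · rintro ⟨j, hj, rfl⟩
        refine ⟨_, ?_, rfl⟩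
        intro h
        apply hj
        have := congrArg (Equiv.swap 0 i) h
        simpa using this
      · rintro ⟨j, hj, rfl⟩
        refine ⟨Equiv.swap 0 i j, ?_, by simp⟩
        intro h
        apply hj
        have := congrArg (Equiv.swap 0 i) h
        simpa using this
    have h3 : ((Equiv.swap 0 i).arrowCongr (Equiv.refl α)) f 0 = f i := by
      simp
    rw [h1, h2, h3]
  have htot : ∑ i, F i ≤ 4 * (∑ a, w a) ^ (t + 1) := by
    simp only [hF]
    rw [Finset.sum_comm, Fintype.sum_pow, Finset.mul_sum]
    refine Finset.sum_le_sum fun f _ => ?_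
    rw [← Finset.mul_sum, mul_comm]
    refine mul_le_mul_of_nonneg_right ?_ (Finset.prod_nonneg fun j _ => (hw _).le)
    rw [Finset.sum_boole]
    exact_mod_cast hG f
  have h0 : F 0 = ∑ g : Fin t → α, (∏ j, w (g j)) *
      ∑ a, (if G (Finset.univ.image g) a then w a else 0) := by
    simp only [hF]
    rw [← Fintype.sum_equiv (Fin.consEquiv (fun _ => α)) (fun x =>
      (w x.1 * ∏ j, w (x.2 j)) * (if G (Finset.univ.image x.2) x.1 then 1 else 0)) _ ?_]
    · rw [Fintype.sum_prod_type, Finset.sum_comm]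
      refine Finset.sum_congr rfl fun g _ => ?_
      rw [Finset.mul_sum]
      refine Finset.sum_congr rfl fun a _ => ?_
      split_ifs <;> ring
    · rintro ⟨a, g⟩
      have : (Finset.univ.erase (0 : Fin (t+1))).image (Fin.cons a g : Fin (t+1) → α) =
          Finset.univ.image g := by
        ext c
        simp only [Finset.mem_image, Finset.mem_erase, Finset.mem_univ, and_true, true_and]
        constructor
        · rintro ⟨j, hj, rfl⟩
          obtain ⟨k, rfl⟩ := Fin.exists_succ_eq.mpr hj
          exact ⟨k, by simp⟩
        · rintro ⟨k, rfl⟩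
          exact ⟨k.succ, Fin.succ_ne_zero k, by simp⟩
      simp only [Fin.consEquiv_apply, Fin.prod_univ_succ, Fin.cons_zero, Fin.cons_succ]
      have this2 : (Finset.univ.erase (0 : Fin (t+1))).image
          ((Fin.consEquiv (fun _ => α)) (a, g)) = Finset.univ.image g := this
      rw [this2]
  rw [Finset.sum_congr rfl (fun i _ => hsym i)] at htot
  simp only [Finset.sum_const, Finset.card_univ, Fintype.card_fin, nsmul_eq_mul] at htot
  rw [← h0, le_div_iff₀ (by positivity)]
  push_cast at htot
  linarith

noncomputable def cellOf (X : ℝ) (S : Finset Ln) (p : Pt) : Trap :=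
  if h : ∃ τ, IsTrap X S p τ then h.choose else ⟨0, 0, 0, 0⟩

/-- data making all cells of points of `Q` well defined -/
structure Setup (X : ℝ) (E H : Finset Ln) (Q : Finset Pt) : Prop where
  X1 : ∀ p ∈ Q, -X ≤ p.1
  X2 : ∀ p ∈ Q, p.1 < X
  up : ∀ p ∈ Q, ∃ s ∈ E, p.2 < ev s p.1
  dn : ∀ p ∈ Q, ∃ s ∈ E, ev s p.1 < p.2
  offE : ∀ p ∈ Q, ∀ s ∈ E, ev s p.1 ≠ p.2
  offH : ∀ p ∈ Q, ∀ s ∈ H, ev s p.1 ≠ p.2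

lemma Setup.mono {X : ℝ} {E H : Finset Ln} {Q Q' : Finset Pt} (h : Setup X E H Q)
    (hQ : Q' ⊆ Q) : Setup X E H Q' :=
  ⟨fun p hp => h.X1 p (hQ hp), fun p hp => h.X2 p (hQ hp), fun p hp => h.up p (hQ hp),
   fun p hp => h.dn p (hQ hp), fun p hp => h.offE p (hQ hp), fun p hp => h.offH p (hQ hp)⟩

lemma Setup.isTrap {X : ℝ} {E H : Finset Ln} {Q : Finset Pt} (h : Setup X E H Q) {p : Pt}
    (hp : p ∈ Q) {S : Finset Ln} (hS : E ⊆ S) : IsTrap X S p (cellOf X S p) := by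
  have : ∃ τ, IsTrap X S p τ := by
    refine exists_isTrap (h.X1 p hp) (h.X2 p hp) ?_ ?_
    · obtain ⟨s, h1, h2⟩ := h.up p hp; exact ⟨s, hS h1, h2⟩
    · obtain ⟨s, h1, h2⟩ := h.dn p hp; exact ⟨s, hS h1, h2⟩
  rw [cellOf, dif_pos this]
  exact this.choose_spec

lemma Setup.off {X : ℝ} {E H : Finset Ln} {Q : Finset Pt} (h : Setup X E H Q) {p : Pt}
    (hp : p ∈ Q) {S : Finset Ln} (hS : S ⊆ E ∪ H) : ∀ s ∈ S, ev s p.1 ≠ p.2 := by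
  intro s hs
  rcases Finset.mem_union.mp (hS hs) with h1 | h1
  exacts [h.offE p hp s h1, h.offH p hp s h1]

lemma conflict_card {X : ℝ} {E H : Finset Ln} {Q : Finset Pt} (h : Setup X E H Q) {p : Pt}
    (hp : p ∈ Q) {t : ℕ} (f : Fin (t + 1) → H) :
    (Finset.univ.filter fun i => (cellOf X
      (E ∪ ((Finset.univ.erase i).image f).image Subtype.val) p).Crosses (f i)).card ≤ 4 := by
  set S : Finset Ln := E ∪ (Finset.univ.image f).image Subtype.val with hS
  have hSsub : ∀ A : Finset H, E ∪ A.image Subtype.val ⊆ E ∪ H := by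
    intro A s hs
    simp only [Finset.mem_union, Finset.mem_image] at hs ⊢
    rcases hs with hs | ⟨a, _, rfl⟩
    · exact Or.inl hs
    · exact Or.inr a.2
  have hT := h.isTrap hp (S := S) Finset.subset_union_left
  obtain ⟨D, hDS, hD4, hD⟩ := hT.defining
  refine le_trans ?_ hD4
  have hnot : ∀ i (s : Ln), s ∈ E ∪ ((Finset.univ.erase i).image f).image Subtype.val →
      ¬ (cellOf X (E ∪ ((Finset.univ.erase i).image f).image Subtype.val) p).Crosses s := by
    intro i s hs
    exact (h.isTrap hp Finset.subset_union_left).not_crosses (h.off hp (hSsub _)) hs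
  refine Finset.card_le_card_of_injOn (fun i => (f i : Ln)) ?_ ?_
  · intro i hi
    simp only [Finset.coe_filter, Finset.mem_univ, true_and, Set.mem_ofPred_eq] at hi
    by_contra hc
    have hsub : D ⊆ E ∪ ((Finset.univ.erase i).image f).image Subtype.val := by
      intro s hs
      have := hDS hs
      simp only [hS, Finset.mem_union, Finset.mem_image, Finset.mem_univ, true_and,
        Finset.mem_erase, and_true] at this ⊢
      rcases this with h1 | ⟨a, ⟨j, rfl⟩, rfl⟩
      · exact Or.inl h1
      · refine Or.inr ⟨_, ⟨j, ?_, rfl⟩, rfl⟩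
        rintro rfl
        exact hc hs
    have hsub2 : E ∪ ((Finset.univ.erase i).image f).image Subtype.val ⊆ S := by
      refine Finset.union_subset_union_right (Finset.image_subset_image
        (Finset.image_subset_image (Finset.subset_univ _)))
    have e1 := hD _ hsub hsub2
    have e2 := h.isTrap hp (S := E ∪ ((Finset.univ.erase i).image f).image Subtype.val)
      Finset.subset_union_left
    rw [← e1.unique e2] at hi
    refine hT.not_crosses (h.off hp (hSsub _)) ?_ hi
    simp [hS]
  · intro i hi j hj hij
    by_contra hne
    simp only [Finset.coe_filter, Finset.mem_univ, true_and, Set.mem_ofPred_eq] at hi hij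
    refine hnot i _ ?_ hi
    rw [hij]
    refine Finset.mem_union_right _ (Finset.mem_image_of_mem _ (Finset.mem_image_of_mem _ ?_))
    simp [Ne.symm hne]

/-- half-open containment -/
def Trap.Has (τ : Trap) (p : Pt) : Prop :=
  τ.a ≤ p.1 ∧ p.1 < τ.b ∧ ev τ.d p.1 < p.2 ∧ p.2 < ev τ.u p.1

/-- few cells -/
lemma exists_code {X : ℝ} {E H : Finset Ln} {Q : Finset Pt} (h : Setup X E H Q)
    {S : Finset Ln} (hE : E ⊆ S) (hS : S ⊆ E ∪ H) :
    ∃ code : Pt → Fin 3 × Ln × Ln, (∀ p ∈ Q, code p ∈ (Finset.univ : Finset (Fin 3)) ×ˢ S ×ˢ S) ∧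
      ∀ p ∈ Q, ∀ q ∈ Q, code p = code q → cellOf X S p = cellOf X S q := by
  have key : ∀ p ∈ Q, ∃ c : Fin 3 × Ln × Ln, c ∈ (Finset.univ : Finset (Fin 3)) ×ˢ S ×ˢ S ∧
      ((c.1 = 0 ∧ (cellOf X S p).a = -X ∧ c.2.1 = (cellOf X S p).u) ∨
       (c.1 = 1 ∧ c.2.1 = (cellOf X S p).u ∧ (cellOf X S p).a = vx c.2.2 c.2.1) ∨
       (c.1 = 2 ∧ c.2.1 = (cellOf X S p).d ∧ (cellOf X S p).a = vx c.2.2 c.2.1)) := by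
    intro p hp
    have hT := h.isTrap hp hE
    rcases hT.ha with e | ⟨s, hs, e1, e2⟩ | ⟨s, hs, e1, e2⟩
    · exact ⟨(0, (cellOf X S p).u, (cellOf X S p).u), by simp [hT.uS], by simp [e]⟩
    · exact ⟨(1, (cellOf X S p).u, s), by simp [hT.uS, hs], by simp [← eq_vx e1 e2]⟩
    · exact ⟨(2, (cellOf X S p).d, s), by simp [hT.dS, hs], by simp [← eq_vx e1 e2]⟩
  choose! code hc1 hc2 using key
  refine ⟨code, hc1, ?_⟩
  intro p hp q hq hpq
  have hTp := h.isTrap hp hE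
  have hTq := h.isTrap hq hE
  have op := h.off hp hS
  have oq := h.off hq hS
  have e1 := hc2 p hp
  have e2 := hc2 q hq
  rw [← hpq] at e2
  rcases e1 with ⟨a1, a2, a3⟩ | ⟨a1, a2, a3⟩ | ⟨a1, a2, a3⟩ <;>
  rcases e2 with ⟨b1, b2, b3⟩ | ⟨b1, b2, b3⟩ | ⟨b1, b2, b3⟩ <;>
  first
  | (exfalso; rw [a1] at b1; revert b1; decide)
  | exact hTp.eq_of_u_a hTq op oq (a3.symm.trans b3) (a2.trans b2.symm)
  | exact hTp.eq_of_u_a hTq op oq (a2.symm.trans b2) (a3.trans b3.symm)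
  | exact hTp.eq_of_d_a hTq op oq (a2.symm.trans b2) (a3.trans b3.symm)

lemma cell_lemma {X : ℝ} {E H : Finset Ln} {Q : Finset Pt} (h : Setup X E H Q)
    (hE2 : E.card ≤ 2) (hH : H.Nonempty) (w : Ln → ℝ) (hw : ∀ a, 0 < w a) (t : ℕ) (ht : 1 ≤ t)
    (q : ℕ) (hq : 1 ≤ q) (hQ : 54 * t ^ 2 * q ≤ Q.card) :
    ∃ (τ : Trap) (Q' : Finset Pt), Q' ⊆ Q ∧ Q'.card = q ∧ (∀ p ∈ Q', τ.Has p) ∧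
      ∑ a ∈ H, (if τ.Crosses a then w a else 0) ≤ 8 * (∑ a ∈ H, w a) / (t + 1) := by
  have : Nonempty H := hH.to_subtype
  set W := ∑ a ∈ H, w a with hW
  have hWpos : 0 < W := Finset.sum_pos (fun a _ => hw a) hH
  have hWsub : ∑ a : H, w a = W := Finset.sum_coe_sort H w
  have hQpos : 0 < Q.card := lt_of_lt_of_le (by positivity) hQ
  -- choose a sample
  set S : (Fin t → H) → Finset Ln := fun g => E ∪ (Finset.univ.image g).image Subtype.val with hS
  set c : (Fin t → H) → Pt → ℝ := fun g p =>
    ∑ a ∈ H, (if (cellOf X (S g) p).Crosses a then w a else 0) with hc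
  have hback : ∀ p ∈ Q, ∑ g : Fin t → H, (∏ j, w (g j)) * c g p ≤ 4 * W ^ (t + 1) / (t + 1) := by
    intro p hp
    have := backwards (fun a : H => w a) (fun a => hw a) t
      (fun A a => (cellOf X (E ∪ A.image Subtype.val) p).Crosses a)
      (fun f => conflict_card h hp f)
    rw [hWsub] at this
    refine le_trans (le_of_eq ?_) this
    refine Finset.sum_congr rfl fun g _ => ?_
    congr 1
    simp only [hc]
    rw [← Finset.sum_coe_sort H]
  have hex : ∃ g : Fin t → H, ∑ p ∈ Q, c g p ≤ 4 * W * Q.card / (t + 1) := by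
    have hsum : ∑ g : Fin t → H, (∏ j, w (g j)) * ∑ p ∈ Q, c g p ≤
        ∑ g : Fin t → H, (∏ j, w (g j)) * (4 * W * Q.card / (t + 1)) := by
      rw [← Finset.sum_mul, ← Fintype.sum_pow (fun a : H => w a), hWsub]
      simp_rw [Finset.mul_sum]
      rw [Finset.sum_comm]
      refine (Finset.sum_le_sum hback).trans (le_of_eq ?_)
      rw [Finset.sum_const, nsmul_eq_mul]
      ring
    obtain ⟨g, _, hg⟩ := Finset.exists_le_of_sum_le (Finset.univ_nonempty) hsum
    exact ⟨g, le_of_mul_le_mul_left hg (Finset.prod_pos fun j _ => hw _)⟩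
  obtain ⟨g, hg⟩ := hex
  have hE : E ⊆ S g := Finset.subset_union_left
  have hSH : S g ⊆ E ∪ H := by
    intro s hs
    simp only [hS, Finset.mem_union, Finset.mem_image] at hs ⊢
    rcases hs with hs | ⟨a, _, rfl⟩
    · exact Or.inl hs
    · exact Or.inr a.2
  have hScard : (S g).card ≤ 3 * t := by
    have h1 := Finset.card_union_le E ((Finset.univ.image g).image Subtype.val)
    have h2 : ((Finset.univ.image g).image (Subtype.val : H → Ln)).card ≤ t :=
      Finset.card_image_le.trans (Finset.card_image_le.trans (by simp))
    simp only [hS]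
    omega
  set good := Q.filter fun p => c g p ≤ 8 * W / (t + 1) with hgood
  have hcnn : ∀ p, 0 ≤ c g p := fun p => Finset.sum_nonneg fun a _ => by
    split_ifs; exacts [(hw a).le, le_rfl]
  have hgoodcard : Q.card ≤ 2 * good.card := by
    have h1 : (8 * W / (t + 1)) * ((Q.filter fun p => ¬ c g p ≤ 8 * W / (t + 1)).card : ℝ) ≤
        4 * W * Q.card / (t + 1) := by
      refine le_trans ?_ hg
      refine le_trans ?_ (Finset.sum_le_sum_of_subset_of_nonneg
        (Finset.filter_subset (fun p => ¬ c g p ≤ 8 * W / (t + 1)) Q) (fun p _ _ => hcnn p))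
      rw [mul_comm, ← nsmul_eq_mul]
      refine Finset.card_nsmul_le_sum _ _ _ ?_
      intro p hp
      exact (not_le.mp (Finset.mem_filter.mp hp).2).le
    have h2 : (2 : ℝ) * ((Q.filter fun p => ¬ c g p ≤ 8 * W / (t + 1)).card : ℝ) ≤ Q.card := by
      have h3 : 0 < 4 * W / (t + 1 : ℝ) := by positivity
      refine le_of_mul_le_mul_left ?_ h3
      calc _ = (8 * W / (t + 1)) * ((Q.filter fun p => ¬ c g p ≤ 8 * W / (t + 1)).card : ℝ) := by
            ring
        _ ≤ _ := h1
        _ = _ := by ring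
    have h3 : 2 * (Q.filter fun p => ¬ c g p ≤ 8 * W / (t + 1)).card ≤ Q.card := by
      exact_mod_cast h2
    have h4 : good.card + (Q.filter fun p => ¬ c g p ≤ 8 * W / (t + 1)).card = Q.card := by
      rw [hgood]
      exact Finset.card_filter_add_card_filter_not _
    omega
  obtain ⟨code, hcode1, hcode2⟩ := exists_code h hE hSH
  set K := (Finset.univ : Finset (Fin 3)) ×ˢ (S g) ×ˢ (S g) with hK
  have hKcard : K.card ≤ 27 * t ^ 2 := by
    simp only [hK, Finset.card_product, Finset.card_univ, Fintype.card_fin]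
    nlinarith
  have hKne : K.Nonempty := by
    obtain ⟨p, hp⟩ := Finset.card_pos.mp hQpos
    exact ⟨_, hcode1 p hp⟩
  obtain ⟨y, hy, hycard⟩ := Finset.exists_le_card_fiber_of_mul_le_card_of_maps_to
    (s := good) (t := K) (f := code) (n := q)
    (fun p hp => hcode1 p (Finset.mem_filter.mp hp).1) hKne (by nlinarith)
  obtain ⟨Q', hQ'1, hQ'2⟩ := Finset.exists_subset_card_eq hycard
  have hQ'ne : Q'.Nonempty := Finset.card_pos.mp (by omega)
  obtain ⟨p0, hp0⟩ := hQ'ne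
  have hmem : ∀ p ∈ Q', p ∈ Q ∧ c g p ≤ 8 * W / (t + 1) ∧ code p = y := by
    intro p hp
    have := hQ'1 hp
    simp only [hgood, Finset.mem_filter] at this
    exact ⟨this.1.1, this.1.2, this.2⟩
  refine ⟨cellOf X (S g) p0, Q', fun p hp => (hmem p hp).1, hQ'2, ?_, (hmem p0 hp0).2.1⟩
  intro p hp
  have := hcode2 p (hmem p hp).1 p0 (hmem p0 hp0).1
    ((hmem p hp).2.2.trans (hmem p0 hp0).2.2.symm)
  rw [← this]
  have hT := h.isTrap (hmem p hp).1 hE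
  exact ⟨hT.ap, hT.pb, hT.pd, hT.pu⟩

/-! ### The partition lemma -/

lemma step_ineq {x : ℝ} (hx : 1 ≤ x) {t : ℝ} (ht0 : 0 ≤ t) (ht : x / 54 < (t + 1) ^ 2) :
    1 + 8 / (t + 1) ≤ Real.exp (118 * (Real.sqrt x - Real.sqrt (x - 1))) := by
  have hs : 0 < Real.sqrt x := Real.sqrt_pos.mpr (by linarith)
  have h1 : Real.sqrt x ^ 2 = x := Real.sq_sqrt (by linarith)
  have h2 : Real.sqrt (x - 1) ^ 2 = x - 1 := Real.sq_sqrt (by linarith)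
  have h0 := Real.sqrt_nonneg (x - 1)
  have h3 : 1 / (2 * Real.sqrt x) ≤ Real.sqrt x - Real.sqrt (x - 1) := by
    rw [div_le_iff₀ (by positivity)]
    nlinarith [sq_nonneg (Real.sqrt x - Real.sqrt (x - 1))]
  have h4 : Real.sqrt x ≤ 59 / 8 * (t + 1) := by
    apply Real.sqrt_le_iff.mpr
    constructor
    · positivity
    · nlinarith [sq_nonneg (t+1)]
  have h5 : 8 / (t + 1) ≤ 59 / Real.sqrt x := by
    rw [div_le_div_iff₀ (by linarith) hs]
    linarith
  have h6 : 59 / Real.sqrt x = 118 * (1 / (2 * Real.sqrt x)) := by field_simp; norm_num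
  have h7 := Real.add_one_le_exp (118 * (Real.sqrt x - Real.sqrt (x - 1)))
  linarith

lemma partition_lemma {X : ℝ} {E H : Finset Ln} (hE2 : E.card ≤ 2) (hH : H.Nonempty)
    (q : ℕ) (hq : 1 ≤ q) : ∀ (N : ℕ) (Q : Finset Pt), Q.card = N → Setup X E H Q →
    ∀ w : Ln → ℝ, (∀ a, 0 < w a) →
    ∃ l : List (Trap × Finset Pt),
      (∀ e ∈ l, e.2 ⊆ Q ∧ e.2.card = q ∧ ∀ p ∈ e.2, e.1.Has p) ∧
      l.length * q ≤ Q.card ∧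
      (Q.filter fun p => ∀ e ∈ l, p ∉ e.2).card ≤ 54 * q ∧
      ∑ h ∈ H, w h * 2 ^ (l.countP fun e => e.1.Crosses h) ≤
        (∑ h ∈ H, w h) * Real.exp (118 * Real.sqrt ((Q.card : ℝ) / q)) := by
  intro N
  induction N using Nat.strong_induction_on with
  | _ N ih =>
  intro Q hQN hset w hw
  have hq0 : (0 : ℝ) < q := by exact_mod_cast hq
  have hW : 0 ≤ ∑ h ∈ H, w h := Finset.sum_nonneg fun a _ => (hw a).le
  by_cases hsmall : Q.card ≤ 54 * q
  · refine ⟨[], by simp, by simp, (Finset.card_filter_le _ _).trans hsmall, ?_⟩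
    simp only [List.countP_nil, pow_zero, mul_one]
    refine le_mul_of_one_le_right hW (Real.one_le_exp ?_)
    positivity
  push Not at hsmall
  set t := Nat.sqrt (Q.card / (54 * q)) with ht
  have hdiv : 1 ≤ Q.card / (54 * q) := (Nat.one_le_div_iff (by omega)).mpr hsmall.le
  have ht1 : 1 ≤ t := by rw [ht, Nat.le_sqrt]; simpa using hdiv
  have ht2 : 54 * t ^ 2 * q ≤ Q.card := by
    have h1 : t * t ≤ Q.card / (54 * q) := Nat.sqrt_le _
    have h2 := Nat.mul_le_mul_right (54 * q) h1
    have h3 := Nat.div_mul_le_self Q.card (54 * q)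
    calc 54 * t ^ 2 * q = t * t * (54 * q) := by ring
      _ ≤ _ := h2.trans h3
  have ht3 : Q.card < (t + 1) ^ 2 * (54 * q) := by
    have h1 : Q.card / (54 * q) < (t + 1) * (t + 1) := Nat.lt_succ_sqrt _
    rw [Nat.div_lt_iff_lt_mul (by omega)] at h1
    calc _ < _ := h1
      _ = _ := by ring
  obtain ⟨τ, Q', hQ'Q, hQ'c, hhas, hcross⟩ := cell_lemma hset hE2 hH w hw t ht1 q hq ht2
  set w' : Ln → ℝ := fun h => w h * (if τ.Crosses h then 2 else 1) with hw'
  have hw'pos : ∀ a, 0 < w' a := by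
    intro a
    simp only [hw']
    have := hw a
    split_ifs <;> linarith
  have hcard : (Q \ Q').card = Q.card - q := by
    rw [Finset.card_sdiff_of_subset hQ'Q, hQ'c]
  have hqQ : q ≤ Q.card := by omega
  obtain ⟨l, hl1, hl2, hl3, hl4⟩ := ih (Q \ Q').card (by omega) (Q \ Q') rfl
    (hset.mono Finset.sdiff_subset) w' hw'pos
  refine ⟨(τ, Q') :: l, ?_, ?_, ?_, ?_⟩
  · intro e he
    rcases List.mem_cons.mp he with rfl | he
    · exact ⟨hQ'Q, hQ'c, hhas⟩
    · exact ⟨(hl1 e he).1.trans Finset.sdiff_subset, (hl1 e he).2⟩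
  · rw [hcard] at hl2
    simp only [List.length_cons]
    rw [Nat.add_mul, one_mul]
    omega
  · refine le_trans (Finset.card_le_card ?_) hl3
    intro p hp
    simp only [Finset.mem_filter, List.mem_cons, forall_eq_or_imp, Finset.mem_sdiff] at hp ⊢
    exact ⟨⟨hp.1, hp.2.1⟩, hp.2.2⟩
  · have e1 : ∑ h ∈ H, w h * 2 ^ (((τ, Q') :: l).countP fun e => e.1.Crosses h) =
        ∑ h ∈ H, w' h * 2 ^ (l.countP fun e => e.1.Crosses h) := by
      refine Finset.sum_congr rfl fun h _ => ?_
      simp only [hw', List.countP_cons]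
      by_cases hc : τ.Crosses h
      · simp [hc, pow_succ]; ring
      · simp [hc]
    have e2 : ∑ h ∈ H, w' h ≤ (∑ h ∈ H, w h) * (1 + 8 / (t + 1)) := by
      have : ∑ h ∈ H, w' h = ∑ h ∈ H, w h + ∑ a ∈ H, (if τ.Crosses a then w a else 0) := by
        rw [← Finset.sum_add_distrib]
        refine Finset.sum_congr rfl fun h _ => ?_
        simp only [hw']
        split_ifs <;> ring
      rw [this]
      calc _ ≤ ∑ h ∈ H, w h + 8 * (∑ h ∈ H, w h) / (t + 1) := by linarith
        _ = _ := by ring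
    have e3 : ((Q \ Q').card : ℝ) / q = (Q.card : ℝ) / q - 1 := by
      rw [hcard, Nat.cast_sub hqQ]
      field_simp
    have e4 := step_ineq (x := (Q.card : ℝ) / q) (t := t)
      (by rw [le_div_iff₀ hq0]; rw [one_mul]; exact_mod_cast hqQ) (by positivity)
      (by
        rw [div_div, div_lt_iff₀ (by positivity)]
        have : ((Q.card : ℕ) : ℝ) < (((t + 1) ^ 2 * (54 * q) : ℕ) : ℝ) := by exact_mod_cast ht3
        push_cast at this
        linarith)
    rw [e1]
    refine hl4.trans ?_
    rw [e3]
    calc _ ≤ ((∑ h ∈ H, w h) * (1 + 8 / (t + 1))) *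
          Real.exp (118 * Real.sqrt ((Q.card : ℝ) / q - 1)) := by gcongr
      _ ≤ ((∑ h ∈ H, w h) * Real.exp (118 * (Real.sqrt ((Q.card : ℝ) / q) -
          Real.sqrt ((Q.card : ℝ) / q - 1)))) *
          Real.exp (118 * Real.sqrt ((Q.card : ℝ) / q - 1)) := by gcongr
      _ = _ := by
        rw [mul_assoc, ← Real.exp_add]
        congr 2
        ring

/-! ### Quantiles -/

lemma exists_gap {ι : Type*} (Z : Finset ι) (v : ι → ℝ) (r : ℝ) :
    ∃ s < r, ∀ z ∈ Z, v z < r → v z < s := by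
  set A := insert (r - 1) ((Z.image v).filter (· < r)) with hA
  have hne : A.Nonempty := ⟨r - 1, by simp [hA]⟩
  have hlt : A.max' hne < r := by
    have := A.max'_mem hne
    simp only [hA, Finset.mem_insert, Finset.mem_filter] at this
    rcases this with h | h
    · rw [h]; linarith
    · exact h.2
  obtain ⟨s, h1, h2⟩ := exists_between hlt
  refine ⟨s, h2, fun z hz hzr => lt_of_le_of_lt (A.le_max' _ ?_) h1⟩
  simp only [hA, Finset.mem_insert, Finset.mem_filter, Finset.mem_image]
  exact Or.inr ⟨⟨z, hz, rfl⟩, hzr⟩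

lemma quantile {ι : Type*} (Z : Finset ι) (v : ι → ℝ) (n : ℕ) (hn : 1 ≤ n)
    (hfib : ∀ r : ℝ, (Z.filter fun z => v z = r).card ≤ n) (k : ℕ) (hk : k ≤ Z.card) :
    ∃ s : ℝ, (∀ z ∈ Z, v z ≠ s) ∧ k ≤ (Z.filter fun z => v z < s).card ∧
      (Z.filter fun z => v z < s).card < k + n := by
  have hex : ∃ N : ℕ, k ≤ N ∧ ∃ s : ℝ, (∀ z ∈ Z, v z ≠ s) ∧
      (Z.filter fun z => v z < s).card = N := by
    obtain ⟨s, hs⟩ : ∃ s, ∀ z ∈ Z, v z < s := by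
      obtain ⟨M, hM⟩ := (Z.image v).exists_le
      refine ⟨M + 1, fun z hz => ?_⟩
      have := hM _ (Finset.mem_image_of_mem v hz)
      linarith
    refine ⟨Z.card, hk, s, fun z hz => (hs z hz).ne, ?_⟩
    rw [Finset.filter_true_of_mem hs]
  obtain ⟨h1, s, h2, h3⟩ := Nat.find_spec hex
  refine ⟨s, h2, h3 ▸ h1, ?_⟩
  by_contra hc
  push Not at hc
  have hne : (Z.filter fun z => v z < s).Nonempty := Finset.card_pos.mp (by omega)
  obtain ⟨z0, hz0, hmax⟩ := Finset.exists_max_image _ v hne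
  rw [Finset.mem_filter] at hz0
  obtain ⟨s', hs', hgap⟩ := exists_gap Z v (v z0)
  have hsplit : (Z.filter fun z => v z < s) ⊆
      (Z.filter fun z => v z < s') ∪ (Z.filter fun z => v z = v z0) := by
    intro z hz
    have hle := hmax z hz
    rw [Finset.mem_filter] at hz
    rw [Finset.mem_union, Finset.mem_filter, Finset.mem_filter]
    rcases hle.lt_or_eq with h | h
    · exact Or.inl ⟨hz.1, hgap z hz.1 h⟩
    · exact Or.inr ⟨hz.1, h⟩
  have hcard := (Finset.card_le_card hsplit).trans (Finset.card_union_le _ _)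
  have hfz := hfib (v z0)
  have hlt : (Z.filter fun z => v z < s').card < (Z.filter fun z => v z < s).card := by
    apply Finset.card_lt_card
    refine Finset.ssubset_iff_of_subset ?_ |>.mpr ⟨z0, by simp [hz0], by simp [hs'.le]⟩
    intro z hz
    rw [Finset.mem_filter] at hz ⊢
    exact ⟨hz.1, by linarith [hz.2, hz0.2]⟩
  refine Nat.find_min hex (h3 ▸ hlt) ⟨by omega, s', ?_, rfl⟩
  intro z hz h
  have := hgap z hz (h ▸ hs')
  linarith

structure Quant (P : Finset Pt) (φ : Pt → ℝ) (b m : ℕ) (c : ℕ → ℝ) : Prop where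
  ne : ∀ i ≤ m, ∀ p ∈ P, φ p ≠ c i
  card : ∀ i ≤ m, (P.filter fun p => φ p < c i).card = i * b

lemma Quant.card_gt {P : Finset Pt} {φ : Pt → ℝ} {b m : ℕ} {c : ℕ → ℝ} (h : Quant P φ b m c)
    {i : ℕ} (hi : i ≤ m) : (P.filter fun p => c i < φ p).card + i * b = P.card := by
  rw [← h.card i hi, ← Finset.card_filter_add_card_filter_not (s := P) (fun p => c i < φ p)]
  congr 2
  refine Finset.filter_congr fun p hp => ?_
  have := h.ne i hi p hp
  constructor
  · intro h; exact not_lt.mpr h.le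
  · intro h; exact lt_of_le_of_ne (not_lt.mp h) this

lemma Quant.lt {P : Finset Pt} {φ : Pt → ℝ} {b m : ℕ} {c : ℕ → ℝ} (h : Quant P φ b m c)
    (hb : 1 ≤ b) {i j : ℕ} (hij : i < j) (hj : j ≤ m) : c i < c j := by
  by_contra hc
  push Not at hc
  have h1 := h.card i (by omega)
  have h2 := h.card j hj
  have h3 : (P.filter fun p => φ p < c j).card ≤ (P.filter fun p => φ p < c i).card :=
    Finset.card_le_card (Finset.monotone_filter_right _ fun p _ hp => lt_of_lt_of_le hp hc)
  rw [h1, h2] at h3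
  have := Nat.le_of_mul_le_mul_right h3 (by omega)
  omega

lemma Quant.card_mid {P : Finset Pt} {φ : Pt → ℝ} {b m : ℕ} {c : ℕ → ℝ} (h : Quant P φ b m c)
    {i j : ℕ} (hi : i ≤ m) (hj : j ≤ m) :
    (P.filter fun p => c i < φ p ∧ φ p < c j).card ≤ j * b - i * b := by
  have h1 : (P.filter fun p => c i < φ p ∧ φ p < c j) ⊆
      (P.filter fun p => φ p < c j) \ (P.filter fun p => φ p < c i) := by
    intro p hp
    simp only [Finset.mem_filter, Finset.mem_sdiff] at hp ⊢
    exact ⟨⟨hp.1, hp.2.2⟩, fun hh => by linarith [hh.2, hp.2.1]⟩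
  refine (Finset.card_le_card h1).trans ?_
  rcases le_total (c i) (c j) with hc | hc
  · rw [Finset.card_sdiff_of_subset, h.card i hi, h.card j hj]
    exact Finset.monotone_filter_right _ fun p _ hp => lt_of_lt_of_le hp hc
  · rw [Finset.sdiff_eq_empty_iff_subset.mpr]
    · simp
    · exact Finset.monotone_filter_right _ fun p _ hp => lt_of_lt_of_le hp hc

lemma switch_card {P : Finset Pt} {b : ℕ} (hb : 1 ≤ b) (R : Finset (Pt × Pt))
    (hR : R.card ≤ 2 * b ^ 2) (A B : Finset Pt) (hB : 2 * b ≤ B.card)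
    (hAB : A ×ˢ B ⊆ R) : A.card ≤ b := by
  have h1 := (Finset.card_le_card hAB).trans hR
  rw [Finset.card_product] at h1
  have h2 : A.card * (2 * b) ≤ b * (2 * b) := by
    calc _ ≤ A.card * B.card := Nat.mul_le_mul_left _ hB
      _ ≤ _ := h1
      _ = _ := by ring
  exact Nat.le_of_mul_le_mul_right h2 (by omega)

/-- points on the far sides: at least `j*b - i*b` points satisfy `φ < c j`, `e i < ψ`. -/
lemma card_cross {P : Finset Pt} {φ ψ : Pt → ℝ} {b m : ℕ} {c e : ℕ → ℝ}
    (h1 : Quant P φ b m c) (h2 : Quant P ψ b m e) {i j : ℕ} (hi : i ≤ m) (hj : j ≤ m) :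
    j * b ≤ (P.filter fun p => φ p < c j ∧ e i < ψ p).card + i * b := by
  rw [← h1.card j hj, ← h2.card i hi]
  refine le_trans (Finset.card_le_card ?_) (Finset.card_union_le _ _)
  intro p hp
  simp only [Finset.mem_filter, Finset.mem_union] at hp ⊢
  rcases lt_or_gt_of_ne (h2.ne i hi p hp.1) with h | h
  · exact Or.inr ⟨hp.1, h⟩
  · exact Or.inl ⟨hp.1, hp.2, h⟩

lemma closure_ge {T : Set Pt} {φ : Pt → ℝ} (hφ : Continuous φ) {c : ℝ}
    (h : ∀ z ∈ T, c < φ z) {z : Pt} (hz : z ∈ closure T) : c ≤ φ z :=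
  closure_minimal (t := {z | c ≤ φ z}) (fun z hz => (h z hz).le)
    (isClosed_le continuous_const hφ) hz

lemma closure_le {T : Set Pt} {φ : Pt → ℝ} (hφ : Continuous φ) {c : ℝ}
    (h : ∀ z ∈ T, φ z < c) {z : Pt} (hz : z ∈ closure T) : φ z ≤ c :=
  closure_minimal (t := {z | φ z ≤ c}) (fun z hz => (h z hz).le)
    (isClosed_le hφ continuous_const) hz

def Clean (T : Set Pt) (φ : Pt → ℝ) (c : ℝ) : Prop :=
  (∀ z ∈ T, c < φ z) ∨ (∀ z ∈ T, φ z < c)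

lemma Clean.above {T : Set Pt} {φ : Pt → ℝ} {c : ℝ} (h : Clean T φ c) {p : Pt} (hp : p ∈ T)
    (h1 : c < φ p) : ∀ z ∈ T, c < φ z := by
  rcases h with h | h
  · exact h
  · exact absurd (h p hp) (not_lt.mpr h1.le)

lemma Clean.below {T : Set Pt} {φ : Pt → ℝ} {c : ℝ} (h : Clean T φ c) {p : Pt} (hp : p ∈ T)
    (h1 : φ p < c) : ∀ z ∈ T, φ z < c := by
  rcases h with h | h
  · exact absurd (h p hp) (not_lt.mpr h1.le)
  · exact h

lemma comb_lt {α β x x' y y' : ℝ} (hα : 0 ≤ α) (hβ : 0 ≤ β) (h : 0 < α + β) (hx : x < x')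
    (hy : y < y') : α * x + β * y < α * x' + β * y' := by
  rcases hα.lt_or_eq with h1 | h1
  · nlinarith [mul_lt_mul_of_pos_left hx h1, mul_le_mul_of_nonneg_left hy.le hβ]
  · have h2 : 0 < β := by linarith
    nlinarith [mul_lt_mul_of_pos_left hy h2, mul_le_mul_of_nonneg_left hx.le hα]

lemma sandwich {P : Finset Pt} {φ ψ : Pt → ℝ} (hφ : Continuous φ) (hψ : Continuous ψ)
    {b m : ℕ} {c e : ℕ → ℝ} (hb : 1 ≤ b) (hm : 1 ≤ m)
    (h1 : Quant P φ b m c) (h2 : Quant P ψ b m e) (hn : P.card ≤ (m + 1) * b)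
    (hsw : ((P ×ˢ P).filter fun x => φ x.2 < φ x.1 ∧ ψ x.1 < ψ x.2).card ≤ 2 * b ^ 2)
    {α β : ℝ} (hα : 0 ≤ α) (hβ : 0 ≤ β) (hαβ : 0 < α + β) (k : ℝ) :
    ∃ Bad : Finset Pt, Bad.card ≤ 6 * b ∧ ∃ I : Finset ℕ, I.card ≤ 2 ∧ (∀ i ∈ I, i ≤ m) ∧
      ∀ T : Set Pt, (∀ i ∈ I, Clean T φ (c i) ∧ Clean T ψ (e i)) →
        (∃ p ∈ P, p ∈ T ∧ p ∉ Bad) → ∀ z ∈ closure T, α * φ z + β * ψ z ≠ k := by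
  have habove : ∀ i ≤ m, k < α * c i + β * e i → ∀ T : Set Pt, (∀ z ∈ T, c i < φ z) →
      (∀ z ∈ T, e i < ψ z) → ∀ z ∈ closure T, α * φ z + β * ψ z ≠ k := by
    intro i hi hk T hT1 hT2 z hz
    have e1 := mul_le_mul_of_nonneg_left (closure_ge hφ hT1 hz) hα
    have e2 := mul_le_mul_of_nonneg_left (closure_ge hψ hT2 hz) hβ
    linarith
  have hbelow : ∀ i, i + 1 ≤ m → α * c (i + 1) + β * e (i + 1) ≤ k → ∀ T : Set Pt,
      (∀ z ∈ T, φ z < c i) →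
      (∀ z ∈ T, ψ z < e i) → ∀ z ∈ closure T, α * φ z + β * ψ z ≠ k := by
    intro i hi hk T hT1 hT2 z hz
    have e1 := mul_le_mul_of_nonneg_left (closure_le hφ hT1 hz) hα
    have e2 := mul_le_mul_of_nonneg_left (closure_le hψ hT2 hz) hβ
    have e3 := comb_lt hα hβ hαβ (h1.lt hb (Nat.lt_succ_self i) hi)
      (h2.lt hb (Nat.lt_succ_self i) hi)
    simp only [Nat.succ_eq_add_one] at e3
    linarith
  by_cases hk1 : k < α * c 1 + β * e 1
  · refine ⟨(P.filter fun p => φ p < c 1) ∪ (P.filter fun p => ψ p < e 1), ?_, {1}, by simp,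
      by simpa using hm, ?_⟩
    · refine (Finset.card_union_le _ _).trans ?_
      rw [h1.card 1 hm, h2.card 1 hm]; omega
    · rintro T hT ⟨p, hp, hpT, hbad⟩
      obtain ⟨c1, c2⟩ := hT 1 (by simp)
      simp only [Finset.mem_union, Finset.mem_filter, hp, true_and, not_or, not_lt] at hbad
      exact habove 1 hm hk1 T
        (c1.above hpT (lt_of_le_of_ne hbad.1 (h1.ne 1 hm p hp).symm))
        (c2.above hpT (lt_of_le_of_ne hbad.2 (h2.ne 1 hm p hp).symm))
  push Not at hk1
  by_cases hkm : α * c m + β * e m ≤ k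
  · obtain ⟨i, rfl⟩ : ∃ i, m = i + 1 := ⟨m - 1, by omega⟩
    refine ⟨(P.filter fun p => c i < φ p) ∪ (P.filter fun p => e i < ψ p), ?_, {i}, by simp,
      by simp, ?_⟩
    · refine (Finset.card_union_le _ _).trans ?_
      have e1 := h1.card_gt (i := i) (by omega)
      have e2 := h2.card_gt (i := i) (by omega)
      have e3 : (i + 1 + 1) * b = i * b + 2 * b := by ring
      omega
    · rintro T hT ⟨p, hp, hpT, hbad⟩
      obtain ⟨c1, c2⟩ := hT i (by simp)
      simp only [Finset.mem_union, Finset.mem_filter, hp, true_and, not_or, not_lt] at hbad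
      exact hbelow i le_rfl hkm T
        (c1.below hpT (lt_of_le_of_ne hbad.1 (h1.ne i (by omega) p hp)))
        (c2.below hpT (lt_of_le_of_ne hbad.2 (h2.ne i (by omega) p hp)))
  push Not at hkm
  have hex : ∃ i, k < α * c i + β * e i ∧ 1 ≤ i := ⟨m, hkm, hm⟩
  obtain ⟨hi1, hi2⟩ := Nat.find_spec hex
  have him : Nat.find hex ≤ m := Nat.find_min' hex ⟨hkm, hm⟩
  have hmin : ∀ j, j < Nat.find hex → ¬ (k < α * c j + β * e j ∧ 1 ≤ j) :=
    fun j hj => Nat.find_min hex hj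
  generalize Nat.find hex = i' at hi1 hi2 him hmin
  have hi1' : i' ≠ 1 := by rintro rfl; linarith
  obtain ⟨i, rfl⟩ : ∃ i, i' = i + 2 := ⟨i' - 2, by omega⟩
  have hik : α * c (i + 1) + β * e (i + 1) ≤ k := by
    have := hmin (i + 1) (by omega)
    by_contra hc
    exact this ⟨not_le.mp hc, by omega⟩
  set R := (P ×ˢ P).filter fun x => φ x.2 < φ x.1 ∧ ψ x.1 < ψ x.2 with hR
  have m1 : i ≤ m := by omega
  refine ⟨((P.filter fun p => c i < φ p ∧ φ p < c (i + 2)) ∪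
    (P.filter fun p => e i < ψ p ∧ ψ p < e (i + 2))) ∪
    ((P.filter fun p => c (i + 2) < φ p ∧ ψ p < e i) ∪
    (P.filter fun p => φ p < c i ∧ e (i + 2) < ψ p)), ?_, {i, i + 2}, Finset.card_le_two, ?_, ?_⟩
  · have a1 := h1.card_mid m1 him
    have a2 := h2.card_mid m1 him
    have ee : (i + 2) * b = i * b + 2 * b := by ring
    have a3 : (P.filter fun p => c (i + 2) < φ p ∧ ψ p < e i).card ≤ b := by
      have := card_cross h1 h2 m1 him
      refine switch_card (P := P) hb R hsw _ (P.filter fun p => φ p < c (i + 2) ∧ e i < ψ p)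
        (by omega) ?_
      rintro ⟨x, y⟩ hxy
      simp only [Finset.mem_product, Finset.mem_filter, hR] at hxy ⊢
      obtain ⟨⟨x1, x2, x3⟩, y1, y2, y3⟩ := hxy
      exact ⟨⟨x1, y1⟩, by linarith, by linarith⟩
    have a4 : (P.filter fun p => φ p < c i ∧ e (i + 2) < ψ p).card ≤ b := by
      have := card_cross h2 h1 m1 him
      refine switch_card (P := P) hb (R.image Prod.swap) (Finset.card_image_le.trans hsw) _
        (P.filter fun p => ψ p < e (i + 2) ∧ c i < φ p) (by omega) ?_
      rintro ⟨x, y⟩ hxy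
      simp only [Finset.mem_product, Finset.mem_filter] at hxy
      obtain ⟨⟨x1, x2, x3⟩, y1, y2, y3⟩ := hxy
      refine Finset.mem_image.mpr ⟨(y, x), ?_, rfl⟩
      simp only [hR, Finset.mem_product, Finset.mem_filter]
      exact ⟨⟨y1, x1⟩, by linarith, by linarith⟩
    have u1 := Finset.card_union_le (P.filter fun p => c i < φ p ∧ φ p < c (i + 2))
      (P.filter fun p => e i < ψ p ∧ ψ p < e (i + 2))
    have u2 := Finset.card_union_le (P.filter fun p => c (i + 2) < φ p ∧ ψ p < e i)
      (P.filter fun p => φ p < c i ∧ e (i + 2) < ψ p)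
    refine (Finset.card_union_le _ _).trans ?_
    omega
  · intro j hj
    simp only [Finset.mem_insert, Finset.mem_singleton] at hj
    omega
  · rintro T hT ⟨p, hp, hpT, hbad⟩
    obtain ⟨c1, c2⟩ := hT i (by simp)
    obtain ⟨c3, c4⟩ := hT (i + 2) (by simp)
    simp only [Finset.mem_union, Finset.mem_filter, hp, true_and, not_or, not_and] at hbad
    obtain ⟨⟨b1, b2⟩, b3, b4⟩ := hbad
    have n1 := h1.ne i m1 p hp
    have n2 := h2.ne i m1 p hp
    have n3 := h1.ne (i + 2) him p hp
    have n4 := h2.ne (i + 2) him p hp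
    have l1 := h1.lt hb (show i < i + 2 by omega) him
    have l2 := h2.lt hb (show i < i + 2 by omega) him
    rcases lt_or_gt_of_ne n1 with g1 | g1
    · rcases lt_or_gt_of_ne n2 with g2 | g2
      · exact hbelow i (by omega) hik T (c1.below hpT g1) (c2.below hpT g2)
      · exfalso
        have := b2 g2
        have := b4 g1
        rcases lt_or_gt_of_ne n4 with g4 | g4 <;> contradiction
    · have g3 : c (i + 2) < φ p := lt_of_le_of_ne (not_lt.mp (b1 g1)) n3.symm
      have g2 : e i < ψ p := lt_of_le_of_ne (not_lt.mp (b3 g3)) n2.symm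
      have g4 : e (i + 2) < ψ p := lt_of_le_of_ne (not_lt.mp (b2 g2)) n4.symm
      exact habove (i + 2) him hi1 T (c3.above hpT g3) (c4.above hpT g4)

/-! ### Test set -/

lemma collinear_of_functional {a b c : ℝ} (hab : a ≠ 0 ∨ b ≠ 0) {S : Set Pt}
    (h : ∀ p ∈ S, a * p.1 + b * p.2 = c) : Collinear ℝ S := by
  rcases Set.eq_empty_or_nonempty S with rfl | ⟨p0, hp0⟩
  · exact collinear_empty ℝ _
  rw [collinear_iff_of_mem hp0]
  refine ⟨(-b, a), fun p hp => ?_⟩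
  have h0 := h p0 hp0
  have h1 := h p hp
  have hab2 : 0 < a ^ 2 + b ^ 2 := by
    rcases hab with h | h
    · have := sq_nonneg b; have := pow_pos (abs_pos.mpr h) 2; rw [sq_abs] at this; linarith
    · have := sq_nonneg a; have := pow_pos (abs_pos.mpr h) 2; rw [sq_abs] at this; linarith
  refine ⟨(a * (p.2 - p0.2) - b * (p.1 - p0.1)) / (a ^ 2 + b ^ 2), ?_⟩
  have hz : a * (p.1 - p0.1) + b * (p.2 - p0.2) = 0 := by linarith
  ext
  · simp only [vadd_eq_add, Prod.fst_add, Prod.smul_fst, smul_eq_mul]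
    field_simp
    linear_combination a * hz
  · simp only [vadd_eq_add, Prod.snd_add, Prod.smul_snd, smul_eq_mul]
    field_simp
    linear_combination b * hz

/-- In general position, a given direction is realised by at most `n` ordered pairs. -/
lemma genPos_dir {P : Finset Pt} (hP : GenPos P) {a b : ℝ} (hab : a ≠ 0 ∨ b ≠ 0) :
    ((P ×ˢ P).filter fun x => x.1 ≠ x.2 ∧
      a * (x.1.1 - x.2.1) + b * (x.1.2 - x.2.2) = 0).card ≤ P.card := by
  refine Finset.card_le_card_of_injOn (fun x => x.1) ?_ ?_
  · intro x hx
    simp only [Finset.coe_filter, Finset.mem_product, Set.mem_ofPred_eq] at hx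
    exact hx.1.1
  · rintro ⟨p, q⟩ hx ⟨p', r⟩ hy h
    simp only [Finset.coe_filter, Finset.mem_product, Set.mem_ofPred_eq] at hx hy h
    subst h
    by_contra hne
    have hqr : q ≠ r := fun h => hne (by rw [h])
    refine hP p hx.1.1 q hx.1.2 r hy.1.2 hx.2.1 hy.2.1 hqr
      (collinear_of_functional (c := a * p.1 + b * p.2) hab ?_)
    intro z hz
    simp only [Set.mem_insert_iff, Set.mem_singleton_iff] at hz
    rcases hz with rfl | rfl | rfl
    · rfl
    · linarith [hx.2.2]
    · linarith [hy.2.2]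

/-- Quantile thresholds for a functional injective on `P`. -/
lemma exists_quant {P : Finset Pt} {φ : Pt → ℝ} (hφ : Set.InjOn φ P) {b m : ℕ}
    (hm : m * b ≤ P.card) : ∃ c, Quant P φ b m c := by
  have hfib : ∀ r : ℝ, (P.filter fun z => φ z = r).card ≤ 1 := by
    intro r
    rw [Finset.card_le_one]
    intro p hp q hq
    rw [Finset.mem_filter] at hp hq
    exact hφ hp.1 hq.1 (hp.2.trans hq.2.symm)
  have : ∀ i, ∃ s, i ≤ m → (∀ p ∈ P, φ p ≠ s) ∧ (P.filter fun p => φ p < s).card = i * b := by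
    intro i
    by_cases hi : i ≤ m
    · obtain ⟨s, h1, h2, h3⟩ := quantile P φ 1 le_rfl hfib (i * b)
        ((Nat.mul_le_mul_right b hi).trans hm)
      exact ⟨s, fun _ => ⟨h1, by omega⟩⟩
    · exact ⟨0, fun h => absurd h hi⟩
  choose c hc using this
  exact ⟨c, fun i hi => (hc i hi).1, fun i hi => (hc i hi).2⟩

/-- The directional functionals. -/
def sg (J j : ℕ) : ℝ := if j ≤ J then 1 else -1

def sl (s : ℕ → ℝ) (J j : ℕ) : ℝ := if j ≤ J then s j else s 0

def G (s : ℕ → ℝ) (J j : ℕ) (z : Pt) : ℝ := sg J j * (z.2 - sl s J j * z.1)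

lemma G_cont (s : ℕ → ℝ) (J j : ℕ) : Continuous (G s J j) := by
  unfold G; fun_prop

lemma sg_cases (J j : ℕ) : sg J j = 1 ∨ sg J j = -1 := by
  unfold sg; split_ifs <;> simp

lemma G_le {s : ℕ → ℝ} {J j : ℕ} (h : j ≤ J) (z : Pt) : G s J j z = z.2 - s j * z.1 := by
  simp [G, sg, sl, h]

lemma G_last (s : ℕ → ℝ) (J : ℕ) (z : Pt) : G s J (J + 1) z = -(z.2 - s 0 * z.1) := by
  simp [G, sg, sl]

/-- Every line is a level set of a nonnegative combination of consecutive functionals. -/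
lemma dir_cover {s : ℕ → ℝ} {J : ℕ} (h0J : s 0 < s J)
    (hmono : ∀ j < J, s j < s (j + 1)) (l : Line) :
    ∃ j ≤ J, ∃ α β k : ℝ, 0 ≤ α ∧ 0 ≤ β ∧ 0 < α + β ∧
      ∀ z ∈ l.toSet, α * G s J j z + β * G s J (j + 1) z = k := by
  have hd : 0 < s J - s 0 := by linarith
  by_cases hb : l.b = 0
  · have ha : l.a ≠ 0 := l.nondeg.resolve_right (by simp [hb])
    refine ⟨J, le_rfl, 1, 1, -(s J - s 0) * (l.c / l.a), by norm_num, by norm_num, by norm_num, ?_⟩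
    intro z hz
    simp only [Line.toSet, Set.mem_ofPred_eq, hb, zero_mul, add_zero] at hz
    rw [G_le le_rfl, G_last, ← hz]
    field_simp
    ring
  · have key : ∀ z ∈ l.toSet, z.2 - (-(l.a / l.b)) * z.1 = l.c / l.b := by
      intro z hz
      simp only [Line.toSet, Set.mem_ofPred_eq] at hz
      rw [← hz]; field_simp; ring
    set t := -(l.a / l.b)
    set k := l.c / l.b
    by_cases h1 : s J ≤ t
    · refine ⟨J, le_rfl, 1 + (t - s J) / (s J - s 0), (t - s J) / (s J - s 0), k, ?_, ?_, ?_, ?_⟩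
      · have : 0 ≤ (t - s J) / (s J - s 0) := div_nonneg (by linarith) hd.le
        linarith
      · exact div_nonneg (by linarith) hd.le
      · have : 0 ≤ (t - s J) / (s J - s 0) := div_nonneg (by linarith) hd.le
        linarith
      · intro z hz
        rw [G_le le_rfl, G_last, ← key z hz]
        field_simp
        ring
    · push Not at h1
      have hex : ∃ j, t < s j := ⟨J, h1⟩
      have hspec := Nat.find_spec hex
      have hJ : Nat.find hex ≤ J := Nat.find_min' hex h1
      have hmin : ∀ i < Nat.find hex, ¬ t < s i := fun i hi => Nat.find_min hex hi
      rcases hj : Nat.find hex with _ | j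
      · rw [hj] at hspec
        refine ⟨J, le_rfl, (s 0 - t) / (s J - s 0), 1 + (s 0 - t) / (s J - s 0), -k, ?_, ?_, ?_, ?_⟩
        · exact div_nonneg (by linarith) hd.le
        · have : 0 ≤ (s 0 - t) / (s J - s 0) := div_nonneg (by linarith) hd.le
          linarith
        · have : 0 ≤ (s 0 - t) / (s J - s 0) := div_nonneg (by linarith) hd.le
          linarith
        · intro z hz
          rw [G_le le_rfl, G_last, ← key z hz]
          field_simp
          ring
      · rw [hj] at hspec hJ hmin
        have hm := hmono j (by omega)
        have h2 := not_lt.mp (hmin j (by omega))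
        refine ⟨j, by omega, s (j + 1) - t, t - s j, (s (j + 1) - s j) * k, by linarith, by linarith,
          by linarith, ?_⟩
        intro z hz
        rw [G_le (by omega), G_le hJ, ← key z hz]
        ring

lemma dir_seq {P : Finset Pt} (hP : GenPos P) {b : ℕ}
    (hb1 : 2 * P.card ≤ b ^ 2) (hb2 : b ^ 2 + 2 * P.card ≤ P.card ^ 2) (hn : 1 ≤ P.card) :
    ∃ (s : ℕ → ℝ) (J : ℕ), J * b ^ 2 ≤ P.card ^ 2 ∧ s 0 < s J ∧ (∀ j < J, s j < s (j + 1)) ∧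
      (∀ j, Set.InjOn (G s J j) P) ∧
      ∀ j ≤ J, ((P ×ˢ P).filter fun x => G s J j x.2 < G s J j x.1 ∧
        G s J (j + 1) x.1 < G s J (j + 1) x.2).card ≤ 2 * b ^ 2 := by
  set n := P.card with hn'
  set Z := (P ×ˢ P).filter fun x => x.1.1 ≠ x.2.1 with hZ
  set v : Pt × Pt → ℝ := fun x => (x.1.2 - x.2.2) / (x.1.1 - x.2.1) with hv
  set V := (P ×ˢ P).filter fun x => x.1 ≠ x.2 ∧ x.1.1 = x.2.1 with hV
  have hVc : V.card ≤ n := by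
    refine le_trans (Finset.card_le_card ?_) (genPos_dir hP (a := 1) (b := 0) (by simp))
    intro x hx
    simp only [hV, Finset.mem_filter] at hx ⊢
    exact ⟨hx.1, hx.2.1, by rw [hx.2.2]; ring⟩
  have hZc : n ^ 2 ≤ Z.card + 2 * n := by
    have h1 : (P ×ˢ P) ⊆ Z ∪ V ∪ P.image (fun p => (p, p)) := by
      rintro ⟨p, q⟩ hx
      simp only [hZ, hV, Finset.mem_union, Finset.mem_filter, Finset.mem_image, hx, true_and]
      by_cases h : p.1 = q.1
      · by_cases h' : p = q
        · subst h'; exact Or.inr ⟨p, (Finset.mem_product.mp hx).1, rfl⟩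
        · exact Or.inl (Or.inr ⟨h', h⟩)
      · exact Or.inl (Or.inl h)
    have h2 := Finset.card_le_card h1
    rw [Finset.card_product, ← hn', ← sq] at h2
    have h3 := Finset.card_union_le (Z ∪ V) (P.image (fun p => (p, p)))
    have h4 := Finset.card_union_le Z V
    have h5 : (P.image (fun p => (p, p))).card ≤ n := Finset.card_image_le
    omega
  have hZle : Z.card ≤ n ^ 2 := by
    refine (Finset.card_filter_le _ _).trans ?_
    rw [Finset.card_product, ← sq]
  have hmemZ : ∀ x ∈ Z, x.1 ≠ x.2 ∧ x.1.1 - x.2.1 ≠ 0 := by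
    intro x hx
    simp only [hZ, Finset.mem_filter] at hx
    exact ⟨fun h => hx.2 (by rw [h]), sub_ne_zero.mpr hx.2⟩
  have hfib : ∀ r : ℝ, (Z.filter fun z => v z = r).card ≤ n := by
    intro r
    refine le_trans (Finset.card_le_card ?_) (genPos_dir hP (a := r) (b := -1) (by simp))
    intro x hx
    rw [Finset.mem_filter] at hx
    have h1 := hmemZ x hx.1
    rw [Finset.mem_filter]
    refine ⟨(Finset.mem_filter.mp hx.1).1, h1.1, ?_⟩
    rw [← hx.2]
    simp only [hv]
    field_simp [h1.2]
    ring
  have hBpos : 0 < b ^ 2 := by omega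
  set J := Z.card / b ^ 2 with hJ
  have hJ1 : J * b ^ 2 ≤ Z.card := Nat.div_mul_le_self _ _
  have hJ2 : Z.card < (J + 1) * b ^ 2 := by
    rw [hJ, mul_comm]; exact Nat.lt_mul_div_succ _ hBpos
  have hJpos : 1 ≤ J := (Nat.one_le_div_iff hBpos).mpr (by omega)
  have hs : ∀ j, ∃ s : ℝ, (∀ z ∈ Z, v z ≠ s) ∧ (j ≤ J →
      j * b ^ 2 ≤ (Z.filter fun z => v z < s).card ∧
      (Z.filter fun z => v z < s).card < j * b ^ 2 + n) := by
    intro j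
    by_cases h : j ≤ J
    · obtain ⟨s, h1, h2, h3⟩ := quantile Z v n hn hfib (j * b ^ 2)
        ((Nat.mul_le_mul_right _ h).trans hJ1)
      exact ⟨s, h1, fun _ => ⟨h2, h3⟩⟩
    · obtain ⟨s, h1, -, -⟩ := quantile Z v n hn hfib 0 (Nat.zero_le _)
      exact ⟨s, h1, fun h' => absurd h' h⟩
  choose s hs1 hs2 using hs
  have hlt : ∀ i j, i < j → j ≤ J → s i < s j := by
    intro i j hij hj
    by_contra hcon
    push Not at hcon
    have h1 := (hs2 i (by omega)).2
    have h2 := (hs2 j hj).1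
    have h3 : (Z.filter fun z => v z < s j).card ≤ (Z.filter fun z => v z < s i).card :=
      Finset.card_le_card fun z hz => by
        rw [Finset.mem_filter] at hz ⊢
        exact ⟨hz.1, lt_of_lt_of_le hz.2 hcon⟩
    have h4 : (i + 1) * b ^ 2 ≤ j * b ^ 2 := Nat.mul_le_mul_right _ hij
    rw [Nat.add_mul, one_mul] at h4
    omega
  refine ⟨s, J, hJ1.trans hZle, hlt 0 J hJpos le_rfl, fun j hj => hlt j (j + 1) (by omega) hj,
    ?_, ?_⟩
  · intro j p hp q hq hpq
    have hc : ∃ i, sl s J j = s i := by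
      unfold sl; split_ifs
      · exact ⟨j, rfl⟩
      · exact ⟨0, rfl⟩
    obtain ⟨i, hi⟩ := hc
    have hpq' : p.2 - s i * p.1 = q.2 - s i * q.1 := by
      simp only [G, hi] at hpq
      rcases sg_cases J j with h | h <;> rw [h] at hpq <;> linarith
    by_cases h : p.1 = q.1
    · refine Prod.ext h ?_
      rw [h] at hpq'; linarith
    · exfalso
      have hz : (p, q) ∈ Z := by
        simp only [hZ, Finset.mem_filter, Finset.mem_product]
        exact ⟨⟨hp, hq⟩, h⟩
      apply hs1 i _ hz
      simp only [hv]
      rw [div_eq_iff (sub_ne_zero.mpr h)]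
      linarith
  · intro j hj
    rcases Nat.lt_or_ge j J with hjJ | hjJ
    · have hsub : ((P ×ˢ P).filter fun x => G s J j x.2 < G s J j x.1 ∧
          G s J (j + 1) x.1 < G s J (j + 1) x.2) ⊆
          (Z.filter fun z => v z < s (j + 1)) \ (Z.filter fun z => v z < s j) := by
        intro x hx
        simp only [Finset.mem_filter] at hx
        obtain ⟨hx0, hx1, hx2⟩ := hx
        rw [G_le hj, G_le hj] at hx1
        rw [G_le hjJ, G_le hjJ] at hx2
        have hss := hlt j (j + 1) (by omega) hjJ
        have hpos : 0 < x.1.1 - x.2.1 := by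
          by_contra hcon
          push Not at hcon
          nlinarith
        simp only [Finset.mem_sdiff, Finset.mem_filter, hZ, hx0, true_and, not_and, not_lt]
        have hne : x.1.1 ≠ x.2.1 := by intro h; rw [h] at hpos; linarith
        refine ⟨⟨hne, ?_⟩, fun _ => ?_⟩
        · simp only [hv]; rw [div_lt_iff₀ hpos]; linarith
        · simp only [hv]; rw [le_div_iff₀ hpos]; linarith
      have h1 := Finset.card_le_card hsub
      rw [Finset.card_sdiff_of_subset (fun z hz => by
        rw [Finset.mem_filter] at hz ⊢
        exact ⟨hz.1, hz.2.trans (hlt j (j + 1) (by omega) hjJ)⟩)] at h1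
      have h2 := (hs2 j hj).1
      have h3 := (hs2 (j + 1) hjJ).2
      rw [Nat.add_mul, one_mul] at h3
      omega
    · obtain rfl : j = J := le_antisymm hj hjJ
      have hsub : ((P ×ˢ P).filter fun x => G s J J x.2 < G s J J x.1 ∧
          G s J (J + 1) x.1 < G s J (J + 1) x.2) ⊆
          (Z \ (Z.filter fun z => v z < s J)) ∪ (Z.filter fun z => v z < s 0) ∪ V := by
        intro x hx
        simp only [Finset.mem_filter] at hx
        obtain ⟨hx0, hx1, hx2⟩ := hx
        rw [G_le le_rfl, G_le le_rfl] at hx1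
        rw [G_last, G_last] at hx2
        simp only [Finset.mem_union, Finset.mem_sdiff, Finset.mem_filter, hZ, hV, hx0, true_and,
          not_and, not_lt]
        rcases lt_trichotomy (x.1.1 - x.2.1) 0 with hneg | h0 | hpos
        · left; right
          refine ⟨sub_ne_zero.mp hneg.ne, ?_⟩
          simp only [hv]; rw [div_lt_iff_of_neg hneg]; linarith
        · right
          refine ⟨fun h => ?_, sub_eq_zero.mp h0⟩
          rw [h] at hx1; exact lt_irrefl _ hx1
        · left; left
          refine ⟨sub_ne_zero.mp hpos.ne', fun _ => ?_⟩
          simp only [hv]; rw [le_div_iff₀ hpos]; linarith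
      have h1 := Finset.card_le_card hsub
      have h2 := Finset.card_union_le ((Z \ (Z.filter fun z => v z < s J)) ∪
        (Z.filter fun z => v z < s 0)) V
      have h3 := Finset.card_union_le (Z \ (Z.filter fun z => v z < s J))
        (Z.filter fun z => v z < s 0)
      rw [Finset.card_sdiff_of_subset (Finset.filter_subset _ _)] at h3
      have h4 := (hs2 J le_rfl).1
      have h5 := (hs2 0 (Nat.zero_le _)).2
      rw [Nat.add_mul, one_mul] at hJ2
      omega

/-- `T` lies strictly on one side of `h`. -/
def OneSide (T : Set Pt) (h : Ln) : Prop :=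
  (∀ z ∈ T, ev h z.1 < z.2) ∨ (∀ z ∈ T, z.2 < ev h z.1)

lemma clean_of_oneSide {T : Set Pt} {s : ℕ → ℝ} {J j : ℕ} {c : ℝ}
    (h : OneSide T (sl s J j, sg J j * c)) : Clean T (G s J j) c := by
  unfold OneSide ev at h
  unfold Clean G
  simp only at h
  rcases sg_cases J j with e | e <;> rw [e] at h ⊢
  · rcases h with h | h
    · left; intro z hz; linarith [h z hz]
    · right; intro z hz; linarith [h z hz]
  · rcases h with h | h
    · right; intro z hz; linarith [h z hz]
    · left; intro z hz; linarith [h z hz]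

lemma test_set {P : Finset Pt} (hP : GenPos P) {b : ℕ}
    (hb1 : 2 * P.card ≤ b ^ 2) (hb2 : b ^ 2 + 2 * P.card ≤ P.card ^ 2) (hn : 1 ≤ P.card) :
    ∃ (H : Finset Ln) (J m : ℕ), J * b ^ 2 ≤ P.card ^ 2 ∧ m * b ≤ P.card ∧ H.Nonempty ∧
      H.card ≤ (J + 2) * (m + 1) ∧
      (∀ p ∈ P, ∀ h ∈ H, ev h p.1 ≠ p.2) ∧
      ∀ l : Line, ∃ Bad : Finset Pt, Bad.card ≤ 6 * b ∧ ∃ H4 ⊆ H, H4.card ≤ 4 ∧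
        ∀ T : Set Pt, (∀ h ∈ H4, OneSide T h) → (∃ p ∈ P, p ∈ T ∧ p ∉ Bad) →
          ∀ z ∈ closure T, z ∉ l.toSet := by
  obtain ⟨s, J, hJ, h0J, hmono, hinj, hsw⟩ := dir_seq hP hb1 hb2 hn
  have hbpos : 1 ≤ b := by
    rcases Nat.eq_zero_or_pos b with rfl | h
    · rw [zero_pow (by norm_num)] at hb1; omega
    · exact h
  set m := P.card / b with hm
  have hmb : m * b ≤ P.card := Nat.div_mul_le_self _ _
  have hmb2 : P.card ≤ (m + 1) * b := by
    rw [hm, mul_comm]; exact (Nat.lt_mul_div_succ _ hbpos).le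
  have hm1 : 1 ≤ m := (Nat.one_le_div_iff hbpos).mpr (by nlinarith)
  have hq : ∀ j, ∃ c, Quant P (G s J j) b m c := fun j => exists_quant (hinj j) hmb
  choose c hc using hq
  set f : ℕ × ℕ → Ln := fun x => (sl s J x.1, sg J x.1 * c x.1 x.2) with hf
  set H := (Finset.range (J + 2) ×ˢ Finset.range (m + 1)).image f with hH
  have hmem : ∀ j i, j ≤ J + 1 → i ≤ m → f (j, i) ∈ H := fun j i hj hi =>
    Finset.mem_image_of_mem _ (by simp only [Finset.mem_product, Finset.mem_range]; omega)
  refine ⟨H, J, m, hJ, hmb, ⟨_, hmem 0 0 (by omega) (by omega)⟩, ?_, ?_, ?_⟩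
  · refine Finset.card_image_le.trans ?_
    simp
  · intro p hp h hh
    obtain ⟨⟨j, i⟩, hx, rfl⟩ := Finset.mem_image.mp hh
    simp only [Finset.mem_product, Finset.mem_range] at hx
    have := (hc j).ne i (by omega) p hp
    intro he
    apply this
    simp only [hf, ev] at he
    unfold G
    rcases sg_cases J j with e | e <;> rw [e] at he ⊢ <;> linarith
  · intro l
    obtain ⟨j, hj, α, β, k, hα, hβ, hαβ, hk⟩ := dir_cover h0J hmono l
    obtain ⟨Bad, hBad, I, hI, hIm, hT⟩ := sandwich (G_cont s J j) (G_cont s J (j + 1)) hbpos hm1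
      (hc j) (hc (j + 1)) hmb2 (hsw j hj) hα hβ hαβ k
    refine ⟨Bad, hBad, I.image (fun i => f (j, i)) ∪ I.image (fun i => f (j + 1, i)), ?_, ?_, ?_⟩
    · intro h hh
      simp only [Finset.mem_union, Finset.mem_image] at hh
      rcases hh with ⟨i, hi, rfl⟩ | ⟨i, hi, rfl⟩
      · exact hmem _ _ (by omega) (hIm i hi)
      · exact hmem _ _ (by omega) (hIm i hi)
    · refine (Finset.card_union_le _ _).trans ?_
      have h1 : (I.image (fun i => f (j, i))).card ≤ I.card := Finset.card_image_le
      have h2 : (I.image (fun i => f (j + 1, i))).card ≤ I.card := Finset.card_image_le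
      omega
    · intro T h1 h2 z hz hzl
      refine hT T (fun i hi => ⟨?_, ?_⟩) h2 z hz (hk z hzl)
      · exact clean_of_oneSide (h1 _ (Finset.mem_union_left _ (Finset.mem_image_of_mem _ hi)))
      · exact clean_of_oneSide (h1 (f (j + 1, i))
          (Finset.mem_union_right _ (Finset.mem_image_of_mem _ hi)))

/-! ### Assembling the arrangement -/

lemma lines_of_list (l : List Line) : ∃ r ≤ l.length, ∃ ℓs : Fin r → Line,
    Function.Injective (fun i => (ℓs i).toSet) ∧ ∀ x ∈ l, ∃ i, x.toSet = (ℓs i).toSet := by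
  set S : Finset (Set Pt) := l.toFinset.image Line.toSet with hS
  have hc : S.card ≤ l.length := Finset.card_image_le.trans (List.toFinset_card_le l)
  have hex : ∀ i : Fin S.card, ∃ x : Line, x.toSet = (S.equivFin.symm i : Set Pt) := by
    intro i
    obtain ⟨x, -, hx⟩ := Finset.mem_image.mp (S.equivFin.symm i).2
    exact ⟨x, hx⟩
  choose ℓs hℓs using hex
  refine ⟨S.card, hc, ℓs, ?_, ?_⟩
  · intro i j hij
    simp only [hℓs] at hij
    exact S.equivFin.symm.injective (Subtype.ext hij)
  · intro x hx
    have hxS : x.toSet ∈ S := Finset.mem_image_of_mem _ (List.mem_toFinset.mpr hx)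
    refine ⟨S.equivFin ⟨_, hxS⟩, ?_⟩
    rw [hℓs]; simp

lemma zone_off {r : ℕ} {ℓs : Fin r → Line} {ℓ : Line} {y : Pt} (hy : y ∈ Zone r ℓs ℓ)
    (i : Fin r) : y ∉ (ℓs i).toSet := by
  obtain ⟨x, hx, hyx, -⟩ := hy
  have := connectedComponentIn_subset _ _ hyx
  exact fun h => this (Set.mem_iUnion.mpr ⟨i, h⟩)

/-- Open trapezoid. -/
def Trap.region (τ : Trap) : Set Pt :=
  {z | τ.a < z.1 ∧ z.1 < τ.b ∧ ev τ.d z.1 < z.2 ∧ z.2 < ev τ.u z.1}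

/-- Non-vertical line. -/
def lnLine (h : Ln) : Line := ⟨-h.1, 1, h.2, Or.inr one_ne_zero⟩

/-- Vertical line. -/
def vLine (a : ℝ) : Line := ⟨1, 0, a, Or.inl one_ne_zero⟩

lemma mem_lnLine {h : Ln} {z : Pt} : z ∈ (lnLine h).toSet ↔ z.2 = ev h z.1 := by
  simp only [Line.toSet, lnLine, Set.mem_ofPred_eq, ev]
  constructor <;> intro h <;> linarith

lemma mem_vLine {a : ℝ} {z : Pt} : z ∈ (vLine a).toSet ↔ z.1 = a := by
  simp [Line.toSet, vLine]

def Trap.lines (τ : Trap) : List Line := [lnLine τ.u, lnLine τ.d, vLine τ.a, vLine τ.b]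

lemma pos_of_preconnected {C : Set Pt} (hC : IsPreconnected C) {g : Pt → ℝ} (hg : Continuous g)
    (h0 : ∀ z ∈ C, g z ≠ 0) {y : Pt} (hy : y ∈ C) (hgy : 0 < g y) : ∀ z ∈ C, 0 < g z := by
  intro z hz
  by_contra hcon
  push Not at hcon
  obtain ⟨w, hw, hw0⟩ := hC.intermediate_value hz hy hg.continuousOn ⟨hcon, hgy.le⟩
  exact h0 w hw hw0

lemma zone_trap {r : ℕ} {ℓs : Fin r → Line} {ℓ : Line} {y : Pt} (hy : y ∈ Zone r ℓs ℓ)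
    {τ : Trap} (hτ : ∀ x ∈ τ.lines, ∃ i, x.toSet = (ℓs i).toSet) (hH : τ.Has y) :
    y ∈ τ.region ∧ ∃ z ∈ closure τ.region, z ∈ ℓ.toSet := by
  obtain ⟨x, hx, hyC, z, hz, hzl⟩ := hy
  set F := (⋃ i, (ℓs i).toSet)ᶜ with hF
  set C := connectedComponentIn F x with hCdef
  have hCp : IsPreconnected C := isPreconnected_connectedComponentIn
  have hoff : ∀ t ∈ τ.lines, ∀ w ∈ C, w ∉ t.toSet := by
    intro t ht w hw hwt
    obtain ⟨i, hi⟩ := hτ t ht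
    rw [hi] at hwt
    exact connectedComponentIn_subset _ _ hw (Set.mem_iUnion.mpr ⟨i, hwt⟩)
  have hu := hoff (lnLine τ.u) (by simp [Trap.lines])
  have hd := hoff (lnLine τ.d) (by simp [Trap.lines])
  have ha := hoff (vLine τ.a) (by simp [Trap.lines])
  have hb := hoff (vLine τ.b) (by simp [Trap.lines])
  obtain ⟨h1, h2, h3, h4⟩ := hH
  have ha' : τ.a < y.1 := lt_of_le_of_ne h1 fun h => ha y hyC (mem_vLine.mpr h.symm)
  have hsub : C ⊆ τ.region := by
    intro w hw
    refine ⟨?_, ?_, ?_, ?_⟩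
    · have := pos_of_preconnected hCp (g := fun z => z.1 - τ.a) (by fun_prop)
        (fun z hz h => ha z hz (mem_vLine.mpr (by linarith))) hyC (by simpa using ha') w hw
      simpa using this
    · have := pos_of_preconnected hCp (g := fun z => τ.b - z.1) (by fun_prop)
        (fun z hz h => hb z hz (mem_vLine.mpr (by linarith))) hyC (by simpa using h2) w hw
      simpa using this
    · have := pos_of_preconnected hCp (g := fun z => z.2 - ev τ.d z.1) (by unfold ev; fun_prop)
        (fun z hz h => hd z hz (mem_lnLine.mpr (by linarith))) hyC (by simpa using h3) w hw
      simpa using this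
    · have := pos_of_preconnected hCp (g := fun z => ev τ.u z.1 - z.2) (by unfold ev; fun_prop)
        (fun z hz h => hu z hz (mem_lnLine.mpr (by linarith))) hyC (by simpa using h4) w hw
      simpa using this
  exact ⟨hsub hyC, z, closure_mono hsub hz, hzl⟩

lemma region_convex (τ : Trap) : Convex ℝ τ.region := by
  have pc : ∀ {α β x y : ℝ}, 0 ≤ α → 0 ≤ β → α + β = 1 → 0 < x → 0 < y → 0 < α * x + β * y := by
    intro α β x y h1 h2 h3 hx hy
    exact (convex_Ioi (0 : ℝ)) hx hy h1 h2 h3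
  intro z hz w hw α β hα hβ hαβ
  obtain ⟨z1, z2, z3, z4⟩ := hz
  obtain ⟨w1, w2, w3, w4⟩ := hw
  obtain rfl : β = 1 - α := by linarith
  unfold Trap.region ev at *
  simp only [Set.mem_ofPred_eq, Prod.fst_add, Prod.snd_add, Prod.smul_fst, Prod.smul_snd,
    smul_eq_mul]
  refine ⟨?_, ?_, ?_, ?_⟩
  · linarith [pc hα hβ hαβ (sub_pos.mpr z1) (sub_pos.mpr w1)]
  · linarith [pc hα hβ hαβ (sub_pos.mpr z2) (sub_pos.mpr w2)]
  · linarith [pc hα hβ hαβ (sub_pos.mpr z3) (sub_pos.mpr w3)]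
  · linarith [pc hα hβ hαβ (sub_pos.mpr z4) (sub_pos.mpr w4)]

lemma crosses_of_not_oneSide {τ : Trap} {h : Ln} (hn : ¬ OneSide τ.region h) : τ.Crosses h := by
  unfold OneSide at hn
  push Not at hn
  obtain ⟨⟨z, hz, hz'⟩, w, hw, hw'⟩ := hn
  have hg : Continuous fun p : Pt => p.2 - ev h p.1 := by unfold ev; fun_prop
  obtain ⟨p, hp, hp0⟩ := (region_convex τ).isPreconnected.intermediate_value hz hw
    hg.continuousOn (show (0 : ℝ) ∈ Set.Icc _ _ from ⟨by simpa using hz', by simpa using hw'⟩)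
  have he : p.2 = ev h p.1 := by simpa [sub_eq_zero] using hp0
  exact ⟨p.1, hp.1, hp.2.1, he ▸ hp.2.2.1, he ▸ hp.2.2.2⟩

/-- The combinatorial core: counting points in the zone. -/
lemma zone_count {P : Finset Pt} {H4 : Finset Ln} {Bad : Finset Pt} {q κ b : ℕ}
    {l : List (Trap × Finset Pt)} {ℓ : Line} {r : ℕ} {ℓs : Fin r → Line}
    (hl : ∀ e ∈ l, e.2 ⊆ P ∧ e.2.card = q ∧ ∀ p ∈ e.2, e.1.Has p)
    (hlines : ∀ e ∈ l, ∀ x ∈ e.1.lines, ∃ i, x.toSet = (ℓs i).toSet)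
    (hleft : (P.filter fun p => ∀ e ∈ l, p ∉ e.2).card ≤ 54 * q)
    (hBad : Bad.card ≤ 6 * b) (hH4 : H4.card ≤ 4)
    (hκ : ∀ h ∈ H4, (l.countP fun e => e.1.Crosses h) ≤ κ)
    (htest : ∀ T : Set Pt, (∀ h ∈ H4, OneSide T h) → (∃ p ∈ P, p ∈ T ∧ p ∉ Bad) →
      ∀ z ∈ closure T, z ∉ ℓ.toSet) :
    ((P : Set Pt) ∩ Zone r ℓs ℓ).ncard ≤ 54 * q + 6 * b + 4 * (κ * q) := by
  set R : Finset Pt := (P.filter fun p => ∀ e ∈ l, p ∉ e.2) ∪ Bad ∪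
    H4.biUnion fun h => (l.filter fun e => e.1.Crosses h).toFinset.biUnion fun e => e.2 with hR
  have hsub : ((P : Set Pt) ∩ Zone r ℓs ℓ) ⊆ (R : Set Pt) := by
    rintro y ⟨hyP, hyZ⟩
    rw [Finset.mem_coe, hR, Finset.mem_union, Finset.mem_union]
    by_cases h1 : ∀ e ∈ l, y ∉ e.2
    · exact Or.inl (Or.inl (Finset.mem_filter.mpr ⟨hyP, h1⟩))
    by_cases h2 : y ∈ Bad
    · exact Or.inl (Or.inr h2)
    right
    push Not at h1
    obtain ⟨e, he, hye⟩ := h1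
    obtain ⟨hreg, z, hz, hzl⟩ := zone_trap hyZ (hlines e he) ((hl e he).2.2 y hye)
    have : ∃ h ∈ H4, ¬ OneSide e.1.region h := by
      by_contra hcon
      push Not at hcon
      exact htest _ hcon ⟨y, hyP, hreg, h2⟩ z hz hzl
    obtain ⟨h, hh, hno⟩ := this
    refine Finset.mem_biUnion.mpr ⟨h, hh, Finset.mem_biUnion.mpr ⟨e, ?_, hye⟩⟩
    rw [List.mem_toFinset, List.mem_filter]
    exact ⟨he, by simpa using crosses_of_not_oneSide hno⟩
  refine (Set.ncard_le_ncard hsub R.finite_toSet).trans ?_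
  rw [Set.ncard_coe_finset]
  have hbi : (H4.biUnion fun h =>
      (l.filter fun e => e.1.Crosses h).toFinset.biUnion fun e => e.2).card ≤ 4 * (κ * q) := by
    refine (Finset.card_biUnion_le_card_mul _ _ (κ * q) ?_).trans (Nat.mul_le_mul_right _ hH4)
    intro h hh
    refine (Finset.card_biUnion_le_card_mul _ _ q ?_).trans (Nat.mul_le_mul_right _ ?_)
    · intro e he
      rw [List.mem_toFinset, List.mem_filter] at he
      exact (hl e he.1).2.1.le
    · refine (List.toFinset_card_le _).trans ?_
      rw [← List.countP_eq_length_filter]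
      exact hκ h hh
  refine (Finset.card_union_le _ _).trans (Nat.add_le_add ?_ hbi)
  exact (Finset.card_union_le _ _).trans (Nat.add_le_add hleft hBad)

lemma exists_box (P : Finset Pt) : ∃ M : ℝ, 0 < M ∧ ∀ p ∈ P, |p.1| < M ∧ |p.2| < M := by
  obtain ⟨M1, h1⟩ := (P.image fun p => |p.1|).exists_le
  obtain ⟨M2, h2⟩ := (P.image fun p => |p.2|).exists_le
  refine ⟨|M1| + |M2| + 1, by positivity, fun p hp => ?_⟩
  have e1 := h1 _ (Finset.mem_image_of_mem _ hp)
  have e2 := h2 _ (Finset.mem_image_of_mem _ hp)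
  have := le_abs_self M1
  have := le_abs_self M2
  have := abs_nonneg M1
  have := abs_nonneg M2
  constructor <;> linarith

lemma setup_box {P : Finset Pt} {M : ℝ} (hM : ∀ p ∈ P, |p.1| < M ∧ |p.2| < M) {H : Finset Ln}
    (hH : ∀ p ∈ P, ∀ h ∈ H, ev h p.1 ≠ p.2) : Setup M {((0 : ℝ), M), (0, -M)} H P where
  X1 p hp := (abs_lt.mp (hM p hp).1).1.le
  X2 p hp := (abs_lt.mp (hM p hp).1).2
  up p hp := ⟨(0, M), by simp, by simpa [ev] using (abs_lt.mp (hM p hp).2).2⟩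
  dn p hp := ⟨(0, -M), by simp, by simpa [ev] using (abs_lt.mp (hM p hp).2).1⟩
  offE p hp s hs := by
    have h1 := abs_lt.mp (hM p hp).2
    simp only [Finset.mem_insert, Finset.mem_singleton] at hs
    rcases hs with rfl | rfl
    · simp only [ev]; intro h; linarith
    · simp only [ev]; intro h; linarith
  offH p hp s hs := hH p hp s hs

/-- Bound on the crossing number extracted from the weight inequality. -/
lemma kappa_bound {ε n q M : ℝ} {κ : ℕ} (hε : 0 < ε) (hq : 0 < q)
    (hqn : ε ^ 2 * n ≤ 2 * 10 ^ 8 * q)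
    (hM : M ≤ (201 / ε) ^ 3)
    (h : (2 : ℝ) ^ κ ≤ M * Real.exp (118 * Real.sqrt (n / q))) :
    (κ : ℝ) * ε ≤ 3400000 := by
  have hs : Real.sqrt (n / q) ≤ 14143 / ε := by
    rw [Real.sqrt_le_left (by positivity), div_pow, div_le_div_iff₀ hq (by positivity)]
    nlinarith
  have hM' : M ≤ Real.exp (603 / ε) := by
    have h1 : 201 / ε ≤ Real.exp (201 / ε) := by
      have := Real.add_one_le_exp (201 / ε); linarith
    calc M ≤ (201 / ε) ^ 3 := hM
      _ ≤ Real.exp (201 / ε) ^ 3 := pow_le_pow_left₀ (by positivity) h1 3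
      _ = Real.exp (603 / ε) := by rw [← Real.exp_nat_mul]; congr 1; push_cast; ring
  have h2 : Real.exp (κ / 2) ≤ 2 ^ κ := by
    have h3 : Real.exp (1 / 2) ≤ 2 := by
      have h4 : Real.exp (1 / 2) ^ 2 = Real.exp 1 := by
        rw [← Real.exp_nat_mul]; congr 1; push_cast; ring
      have := Real.exp_one_lt_d9
      nlinarith [Real.exp_pos (1 / 2 : ℝ)]
    calc Real.exp (κ / 2) = Real.exp (1 / 2) ^ κ := by
          rw [← Real.exp_nat_mul]; congr 1; ring
      _ ≤ 2 ^ κ := pow_le_pow_left₀ (Real.exp_pos _).le h3 κ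
  have h5 : Real.exp (κ / 2) ≤ Real.exp (603 / ε + 118 * (14143 / ε)) := by
    rw [Real.exp_add]
    refine h2.trans (h.trans ?_)
    refine mul_le_mul hM' (Real.exp_le_exp.mpr (by linarith)) (Real.exp_pos _).le
      (Real.exp_pos _).le
  rw [Real.exp_le_exp] at h5
  have h6 : (603 / ε + 118 * (14143 / ε)) * ε = 1669477 := by field_simp; norm_num
  have h7 := mul_le_mul_of_nonneg_right h5 hε.le
  rw [h6] at h7
  linarith

lemma card_bound {ε n b J m : ℝ} (hε : 0 < ε) (hε1 : ε < 1) (hb : ε * n ≤ 200 * b)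
    (hbp : 0 < b) (hm0 : 0 ≤ m) (hJ0 : 0 ≤ J) (hn : 0 ≤ n)
    (hJ : J * b ^ 2 ≤ n ^ 2) (hm : m * b ≤ n) : (J + 2) * (m + 1) ≤ (201 / ε) ^ 3 := by
  have hm' : m ≤ 200 / ε := by
    rw [le_div_iff₀ hε]
    have : (m * ε) * b ≤ 200 * b := by nlinarith
    exact le_of_mul_le_mul_right this hbp
  have hJ' : J ≤ 40000 / ε ^ 2 := by
    rw [le_div_iff₀ (by positivity)]
    have h1 : (ε * n) ^ 2 ≤ (200 * b) ^ 2 := pow_le_pow_left₀ (by positivity) hb 2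
    have : (J * ε ^ 2) * b ^ 2 ≤ 40000 * b ^ 2 := by nlinarith [sq_nonneg ε]
    exact le_of_mul_le_mul_right this (by positivity)
  have h1 : 1 ≤ 1 / ε := by rw [le_div_iff₀ hε]; linarith
  have h2 : 1 ≤ 1 / ε ^ 2 := by
    rw [le_div_iff₀ (by positivity)]; nlinarith
  have e1 : J + 2 ≤ 40002 * (1 / ε ^ 2) := by
    have : 40000 / ε ^ 2 = 40000 * (1 / ε ^ 2) := by ring
    linarith
  have e2 : m + 1 ≤ 201 * (1 / ε) := by
    have : 200 / ε = 200 * (1 / ε) := by ring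
    linarith
  calc (J + 2) * (m + 1) ≤ (40002 * (1 / ε ^ 2)) * (201 * (1 / ε)) :=
        mul_le_mul e1 e2 (by linarith) (by positivity)
    _ = 8040402 * (1 / ε ^ 3) := by field_simp; norm_num
    _ ≤ 8120601 * (1 / ε ^ 3) := by gcongr; norm_num
    _ = (201 / ε) ^ 3 := by rw [div_pow]; ring

lemma large_case {P : Finset Pt} (hP : GenPos P) {ε : ℝ} (hε : 0 < ε) (hε1 : ε < 1)
    (hbig : 10 ^ 8 < ε ^ 2 * P.card) :
    ∃ (r : ℕ) (ℓs : Fin r → Line), Function.Injective (fun i => (ℓs i).toSet) ∧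
        (r : ℝ) ≤ 10 ^ 9 / ε ^ 2 ∧
        ∀ ℓ : Line, (((P : Set Pt) ∩ Zone r ℓs ℓ).ncard : ℝ) ≤ ε * (P.card : ℝ) := by
  set n : ℝ := (P.card : ℝ) with hn
  have hn0 : 0 < n := by
    by_contra h; push Not at h
    nlinarith [sq_nonneg ε]
  have hεn : 10 ^ 8 < ε * n := by nlinarith [mul_pos hε hn0]
  have hnbig : 10 ^ 8 < n := by nlinarith
  set b := ⌊ε * n / 100⌋₊ with hb
  set q := ⌊ε ^ 2 * n / 10 ^ 8⌋₊ with hq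
  have hb1 : (b : ℝ) ≤ ε * n / 100 := Nat.floor_le (by positivity)
  have hb2 : ε * n / 100 < b + 1 := Nat.lt_floor_add_one _
  have hb3 : ε * n ≤ 200 * b := by linarith
  have hbp : (0 : ℝ) < b := by linarith
  have hq1 : (q : ℝ) ≤ ε ^ 2 * n / 10 ^ 8 := Nat.floor_le (by positivity)
  have hq2 : ε ^ 2 * n / 10 ^ 8 < q + 1 := Nat.lt_floor_add_one _
  have hqone : 1 ≤ q := Nat.le_floor (by push_cast; rw [le_div_iff₀ (by norm_num)]; linarith)
  have hqone' : (1 : ℝ) ≤ q := by exact_mod_cast hqone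
  have hq3 : ε ^ 2 * n ≤ 2 * 10 ^ 8 * q := by
    rw [div_lt_iff₀ (by norm_num)] at hq2
    linarith
  have c1 : 2 * P.card ≤ b ^ 2 := by
    have : 2 * n ≤ (b : ℝ) ^ 2 := by
      have h1 : (ε * n) ^ 2 ≤ (200 * b) ^ 2 := pow_le_pow_left₀ (by positivity) hb3 2
      nlinarith
    rw [hn] at this
    exact_mod_cast this
  have c2 : b ^ 2 + 2 * P.card ≤ P.card ^ 2 := by
    have : (b : ℝ) ^ 2 + 2 * n ≤ n ^ 2 := by
      have h1 : (b : ℝ) ≤ n / 100 := by nlinarith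
      have h2 : (b : ℝ) ^ 2 ≤ (n / 100) ^ 2 := pow_le_pow_left₀ hbp.le h1 2
      nlinarith
    rw [hn] at this
    exact_mod_cast this
  have c3 : 1 ≤ P.card := by
    have : (0 : ℝ) < (P.card : ℝ) := hn0
    exact_mod_cast this
  obtain ⟨H, J, m, hJ, hm, hHne, hHc, hoff, htest⟩ := test_set hP c1 c2 c3
  obtain ⟨M, hM0, hM⟩ := exists_box P
  obtain ⟨l, hl, hlen, hleft, hsum⟩ := partition_lemma (Finset.card_le_two) hHne q hqone P.card P
    rfl (setup_box hM hoff) (fun _ => 1) (fun _ => one_pos)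
  obtain ⟨r, hr, ℓs, hinj, hcov⟩ := lines_of_list (l.flatMap fun e => e.1.lines)
  refine ⟨r, ℓs, hinj, ?_, ?_⟩
  · have h1 : (l.flatMap fun e => e.1.lines).length = 4 * l.length := by
      rw [List.length_flatMap]
      simp [Trap.lines, mul_comm]
    rw [h1] at hr
    have h2 : (r : ℝ) ≤ 4 * l.length := by exact_mod_cast hr
    have h3 : (l.length : ℝ) * q ≤ n := by rw [hn]; exact_mod_cast hlen
    rw [le_div_iff₀ (by positivity)]
    have h4 : ((r : ℝ) * ε ^ 2) * n ≤ 10 ^ 9 * n := by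
      have h0 : (0 : ℝ) ≤ r := Nat.cast_nonneg _
      calc ((r : ℝ) * ε ^ 2) * n = r * (ε ^ 2 * n) := by ring
        _ ≤ (4 * (l.length : ℝ)) * (2 * 10 ^ 8 * (q : ℝ)) := mul_le_mul h2 hq3 (by positivity) (by positivity)
        _ = 8 * 10 ^ 8 * ((l.length : ℝ) * (q : ℝ)) := by ring
        _ ≤ 8 * 10 ^ 8 * n := by gcongr
        _ ≤ 10 ^ 9 * n := by gcongr; norm_num
    exact le_of_mul_le_mul_right h4 hn0
  · intro ℓ
    obtain ⟨Bad, hBad, H4, hH4, hH4c, hT⟩ := htest ℓ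
    set κ := ⌊3400000 / ε⌋₊ with hκ
    have hκ1 : (κ : ℝ) ≤ 3400000 / ε := Nat.floor_le (by positivity)
    have hMc : (H.card : ℝ) ≤ (201 / ε) ^ 3 := by
      refine le_trans ?_ (card_bound (n := n) (b := b) (J := J) (m := m) hε hε1 hb3 hbp
        (Nat.cast_nonneg _) (Nat.cast_nonneg _) hn0.le ?_ ?_)
      · exact_mod_cast hHc
      · rw [hn]; exact_mod_cast hJ
      · rw [hn]; exact_mod_cast hm
    have hκb : ∀ h ∈ H4, (l.countP fun e => e.1.Crosses h) ≤ κ := by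
      intro h hh
      apply Nat.le_floor
      rw [le_div_iff₀ hε]
      refine kappa_bound (M := H.card) (n := n) (q := q) hε (by linarith) hq3 hMc ?_
      have h1 := Finset.single_le_sum
        (f := fun h => (1 : ℝ) * 2 ^ (l.countP fun e => e.1.Crosses h))
        (fun i _ => by positivity) (hH4 hh)
      simp only [one_mul] at h1
      simp only [one_mul, Finset.sum_const, nsmul_eq_mul, mul_one] at hsum
      exact h1.trans hsum
    have hcount := zone_count (ℓ := ℓ) hl (fun e he x hx => hcov x
      (List.mem_flatMap.mpr ⟨e, he, hx⟩)) hleft hBad hH4c hκb hT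
    have hcount' : (((P : Set Pt) ∩ Zone r ℓs ℓ).ncard : ℝ) ≤ 54 * q + 6 * b + 4 * (κ * q) := by
      exact_mod_cast hcount
    refine hcount'.trans ?_
    have e1 : (κ : ℝ) * q ≤ 3400000 / ε * (ε ^ 2 * n / 10 ^ 8) :=
      mul_le_mul hκ1 hq1 (Nat.cast_nonneg _) (by positivity)
    have e2 : 3400000 / ε * (ε ^ 2 * n / 10 ^ 8) = 34 / 1000 * (ε * n) := by field_simp; norm_num
    have e3 : ε ^ 2 * n ≤ ε * n := by nlinarith [mul_pos hε hn0]
    linarith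

lemma small_case (P : Finset Pt) {ε : ℝ} (hε : 0 < ε) (hsmall : ε ^ 2 * P.card ≤ 10 ^ 8) :
    ∃ (r : ℕ) (ℓs : Fin r → Line), Function.Injective (fun i => (ℓs i).toSet) ∧
        (r : ℝ) ≤ 10 ^ 9 / ε ^ 2 ∧
        ∀ ℓ : Line, (((P : Set Pt) ∩ Zone r ℓs ℓ).ncard : ℝ) ≤ ε * (P.card : ℝ) := by
  obtain ⟨r, hr, ℓs, hinj, hcov⟩ := lines_of_list (P.toList.map fun p => vLine p.1)
  refine ⟨r, ℓs, hinj, ?_, ?_⟩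
  · rw [List.length_map, Finset.length_toList] at hr
    rw [le_div_iff₀ (by positivity)]
    have : (r : ℝ) ≤ P.card := by exact_mod_cast hr
    nlinarith [sq_nonneg ε]
  · intro ℓ
    have : (P : Set Pt) ∩ Zone r ℓs ℓ = ∅ := by
      rw [Set.eq_empty_iff_forall_notMem]
      rintro y ⟨hyP, hyZ⟩
      obtain ⟨i, hi⟩ := hcov (vLine y.1) (List.mem_map.mpr ⟨y, Finset.mem_toList.mpr hyP, rfl⟩)
      exact zone_off hyZ i (hi ▸ mem_vLine.mpr rfl)
    rw [this]
    simp only [Set.ncard_empty, Nat.cast_zero]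
    positivity

/-- There is an absolute constant `c > 0` such that for every `n`-element planar
point set `P` in general position and every `ε > 0`, there exists a finite set `L` of at most
`c/ε²` lines such that for every line `ℓ ∉ L`, the zone of `ℓ` within the arrangement of `L`
contains at most `ε·n` points of `P`. -/
theorem stmt8 :
    ∃ c : ℝ, 0 < c ∧ ∀ P : Finset Pt, GenPos P → ∀ ε : ℝ, 0 < ε →
      ∃ (r : ℕ) (ℓs : Fin r → Line),
        Function.Injective (fun i => (ℓs i).toSet) ∧
        (r : ℝ) ≤ c / ε ^ 2 ∧
        ∀ ℓ : Line, (∀ i, ℓ.toSet ≠ (ℓs i).toSet) →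
          (((P : Set Pt) ∩ Zone r ℓs ℓ).ncard : ℝ) ≤ ε * (P.card : ℝ) := by
  refine ⟨10 ^ 9, by norm_num, fun P hP ε hε => ?_⟩
  rcases le_or_gt 1 ε with h1 | h1
  · refine ⟨0, Fin.elim0, fun i => i.elim0, by rw [Nat.cast_zero]; positivity, fun ℓ _ => ?_⟩
    have : ((P : Set Pt) ∩ Zone 0 Fin.elim0 ℓ).ncard ≤ P.card := by
      rw [← Set.ncard_coe_finset P]
      exact Set.ncard_le_ncard Set.inter_subset_left P.finite_toSet
    have h2 : (((P : Set Pt) ∩ Zone 0 Fin.elim0 ℓ).ncard : ℝ) ≤ P.card := by exact_mod_cast this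
    have h3 : (0 : ℝ) ≤ P.card := Nat.cast_nonneg _
    nlinarith
  · rcases le_or_gt (ε ^ 2 * P.card) (10 ^ 8) with h2 | h2
    · obtain ⟨r, ℓs, a, b, c⟩ := small_case P hε h2
      exact ⟨r, ℓs, a, b, fun ℓ _ => c ℓ⟩
    · obtain ⟨r, ℓs, a, b, c⟩ := large_case hP hε h1 h2
      exact ⟨r, ℓs, a, b, fun ℓ _ => c ℓ⟩
end

section
/- For all integers d ≥ 2 and r ≥ d + 1, there exists a constant c = c(d, r) > 0 such that for all pairwise disjoint finite sets X₁, …, X_r in ℝ^d whose union is in general position, there exist subsets Y₁ ⊆ X₁, …, Y_r ⊆ X_r having the same-type property and satisfying |Yᵢ| ≥ c·|Xᵢ| for every i. -/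
open scoped Classical

/-- A set of points in `ℝ^d` is in general position if every `d+1` of its points are
affinely independent. -/
def GenPosD (d : ℕ) (S : Set (Fin d → ℝ)) : Prop :=
  ∀ f : Fin (d + 1) → (Fin d → ℝ), Function.Injective f → (∀ i, f i ∈ S) →
    AffineIndependent ℝ f

/-- The orientation of a `(d+1)`-tuple of points in `ℝ^d`: the sign of the determinant of the
`(d+1)×(d+1)` matrix whose first row is all ones and whose `j`-th column below the first entry
is the coordinate vector of the `j`-th point. -/
noncomputable def orient (d : ℕ) (p : Fin (d + 1) → (Fin d → ℝ)) : ℝ :=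
  Real.sign (Matrix.det (Matrix.of fun i j =>
    Fin.cases (motive := fun _ => ℝ) 1 (fun i' => p j i') i))

/-- Sets `Y 0, …, Y d` in `ℝ^d` have the same-type property if every choice of one point from
each set yields a tuple with the same nonzero orientation. -/
def SameTypeTuple (d : ℕ) (Y : Fin (d + 1) → Finset (Fin d → ℝ)) : Prop :=
  ∃ o : ℝ, o ≠ 0 ∧ ∀ y : Fin (d + 1) → (Fin d → ℝ), (∀ i, y i ∈ Y i) → orient d y = o

/-- Sets `Y 0, …, Y (r-1)` in `ℝ^d` have the same-type property if any `d + 1` of them do. -/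
def SameTypeProp (d r : ℕ) (Y : Fin r → Finset (Fin d → ℝ)) : Prop :=
  ∀ σ : Fin (d + 1) → Fin r, Function.Injective σ → SameTypeTuple d (Y ∘ σ)


/-- Sign homogenization for one multilinear form in `k` arguments, weighted density version. -/
def PStep {α : Type} {m : ℕ} (ι : α → Fin m → ℝ) (k : ℕ) : Prop :=
  ∀ ε : ℝ, 0 < ε → ∃ δ : ℝ, 0 < δ ∧
    ∀ (f : MultilinearMap ℝ (fun _ : Fin k => (Fin m → ℝ)) ℝ) (X : Fin k → Finset α)
      (w : (Fin k → α) → ℝ),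
      (∀ b, 0 ≤ w b) → (∀ b, w b ≤ 1) →
      (∀ b, w b ≠ 0 → 0 ≤ f (fun i => ι (b i))) →
      ε * ((Fintype.piFinset X).card : ℝ) ≤ ∑ b ∈ Fintype.piFinset X, w b →
      ∃ Y : Fin k → Finset α, (∀ i, Y i ⊆ X i) ∧
        (∀ b ∈ Fintype.piFinset Y, 0 ≤ f (fun i => ι (b i))) ∧
        δ * ((Fintype.piFinset X).card : ℝ) ≤ ∑ b ∈ Fintype.piFinset Y, w b

/-- The bipartite version with `D` terms. -/
def QConcl {α : Type} {m : ℕ} (ι : α → Fin m → ℝ) (k D : ℕ)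
    (S : (Fin D → MultilinearMap ℝ (fun _ : Fin k => (Fin m → ℝ)) ℝ) →
      (α → (Fin k → α) → ℝ) → Prop) : Prop :=
  ∀ ε : ℝ, 0 < ε → ∃ δ : ℝ, 0 < δ ∧
    ∀ (φ : Fin D → α → ℝ) (ψ : Fin D → MultilinearMap ℝ (fun _ : Fin k => (Fin m → ℝ)) ℝ)
      (A : Finset α) (X : Fin k → Finset α)
      (w : α → (Fin k → α) → ℝ),
      A.Nonempty → (∀ a b, 0 ≤ w a b) → (∀ a b, w a b ≤ 1) →
      (∀ a b, w a b ≠ 0 → 0 ≤ ∑ j, φ j a * ψ j (fun i => ι (b i))) →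
      S ψ w →
      ε * ((A.card : ℝ) * ((Fintype.piFinset X).card : ℝ)) ≤
        ∑ a ∈ A, ∑ b ∈ Fintype.piFinset X, w a b →
      ∃ (A' : Finset α) (Y : Fin k → Finset α), A' ⊆ A ∧ (∀ i, Y i ⊆ X i) ∧
        (∀ a ∈ A', ∀ b ∈ Fintype.piFinset Y, 0 ≤ ∑ j, φ j a * ψ j (fun i => ι (b i))) ∧
        δ * ((A.card : ℝ) * ((Fintype.piFinset X).card : ℝ)) ≤
          ∑ a ∈ A', ∑ b ∈ Fintype.piFinset Y, w a b

def QStep {α : Type} {m : ℕ} (ι : α → Fin m → ℝ) (k D : ℕ) : Prop :=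
  QConcl ι k D (fun _ _ => True)

/-- `PStep` with an additional, averaged, coordinate. -/
lemma PStep.ext {α : Type} {m : ℕ} {ι : α → Fin m → ℝ} {k : ℕ} (h : PStep ι k) :
    ∀ ε : ℝ, 0 < ε → ∃ δ : ℝ, 0 < δ ∧
    ∀ (f : MultilinearMap ℝ (fun _ : Fin k => (Fin m → ℝ)) ℝ) (A : Finset α)
      (X : Fin k → Finset α) (w : α → (Fin k → α) → ℝ),
      A.Nonempty → (∀ a b, 0 ≤ w a b) → (∀ a b, w a b ≤ 1) →
      (∀ a b, w a b ≠ 0 → 0 ≤ f (fun i => ι (b i))) →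
      ε * ((A.card : ℝ) * ((Fintype.piFinset X).card : ℝ)) ≤
        ∑ a ∈ A, ∑ b ∈ Fintype.piFinset X, w a b →
      ∃ Y : Fin k → Finset α, (∀ i, Y i ⊆ X i) ∧
        (∀ b ∈ Fintype.piFinset Y, 0 ≤ f (fun i => ι (b i))) ∧
        δ * ((A.card : ℝ) * ((Fintype.piFinset X).card : ℝ)) ≤
          ∑ a ∈ A, ∑ b ∈ Fintype.piFinset Y, w a b := by
  intro ε hε
  obtain ⟨δ, hδ, H⟩ := h ε hε
  refine ⟨δ, hδ, ?_⟩
  intro f A X w hA w0 w1 hw hd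
  have hA' : (0 : ℝ) < A.card := by exact_mod_cast hA.card_pos
  obtain ⟨Y, hY, hf, hs⟩ := H f X (fun b => (∑ a ∈ A, w a b) / A.card)
    (fun b => div_nonneg (Finset.sum_nonneg fun a _ => w0 a b) hA'.le)
    (fun b => by
      rw [div_le_one hA']
      calc ∑ a ∈ A, w a b ≤ ∑ a ∈ A, (1 : ℝ) := Finset.sum_le_sum fun a _ => w1 a b
        _ = A.card := by simp)
    (fun b hb => by
      have : ∑ a ∈ A, w a b ≠ 0 := fun h => hb (by simp [h])
      obtain ⟨a, -, ha⟩ := Finset.exists_ne_zero_of_sum_ne_zero this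
      exact hw a b ha)
    (by
      rw [← Finset.sum_div, Finset.sum_comm, le_div_iff₀ hA']
      linarith)
  refine ⟨Y, hY, hf, ?_⟩
  rw [← Finset.sum_div, Finset.sum_comm, le_div_iff₀ hA'] at hs
  linarith

/-- Choice of the pivot. -/
lemma exists_pivot {α β : Type} (A : Finset α) (P : Finset β) (w h : α → β → ℝ)
    (w0 : ∀ a b, 0 ≤ w a b) (ε : ℝ) (hε : 0 < ε) (hA : A.Nonempty) (hP : P.Nonempty)
    (hd : ε * ((A.card : ℝ) * (P.card : ℝ)) ≤ ∑ a ∈ A, ∑ b ∈ P, w a b) :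
    ∃ b0 ∈ P, ε ^ 2 / 2 * ((A.card : ℝ) * (P.card : ℝ)) ≤
      ∑ a ∈ A, ∑ b ∈ P, (if h a b0 ≤ h a b then w a b * w a b0 else 0) := by
  have hA' : (0 : ℝ) < A.card := by exact_mod_cast hA.card_pos
  have hP' : (0 : ℝ) < P.card := by exact_mod_cast hP.card_pos
  by_contra! hc
  have h1 : ∑ b0 ∈ P, ∑ a ∈ A, ∑ b ∈ P, (if h a b0 ≤ h a b then w a b * w a b0 else 0)
      < ∑ b0 ∈ P, ε ^ 2 / 2 * ((A.card : ℝ) * (P.card : ℝ)) :=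
    Finset.sum_lt_sum_of_nonempty hP hc
  rw [Finset.sum_const, nsmul_eq_mul, Finset.sum_comm] at h1
  have h2 : ∀ a ∈ A, (∑ b ∈ P, w a b) ^ 2 / 2 ≤
      ∑ b0 ∈ P, ∑ b ∈ P, (if h a b0 ≤ h a b then w a b * w a b0 else 0) := by
    intro a _
    have e1 : (∑ b ∈ P, w a b) ^ 2 = ∑ b0 ∈ P, ∑ b ∈ P, w a b * w a b0 := by
      rw [sq, Finset.sum_mul_sum, Finset.sum_comm]
    have e2 : ∑ b0 ∈ P, ∑ b ∈ P, w a b * w a b0 ≤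
        ∑ b0 ∈ P, ∑ b ∈ P, ((if h a b0 ≤ h a b then w a b * w a b0 else 0) +
          (if h a b ≤ h a b0 then w a b0 * w a b else 0)) := by
      refine Finset.sum_le_sum fun b0 _ => Finset.sum_le_sum fun b _ => ?_
      have := mul_nonneg (w0 a b) (w0 a b0)
      rcases le_total (h a b0) (h a b) with hh | hh
      · rw [if_pos hh]; split_ifs <;> nlinarith
      · rw [if_pos hh]; split_ifs <;> nlinarith
    simp_rw [Finset.sum_add_distrib] at e2
    rw [Finset.sum_comm (f := fun b0 b => if h a b ≤ h a b0 then w a b0 * w a b else 0)] at e2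
    linarith
  have h3 := Finset.sum_le_sum h2
  rw [← Finset.sum_div] at h3
  have h4 := sq_sum_le_card_mul_sum_sq (s := A) (f := fun a => ∑ b ∈ P, w a b)
  have h5 : (ε * ((A.card : ℝ) * (P.card : ℝ))) ^ 2 ≤ (∑ a ∈ A, ∑ b ∈ P, w a b) ^ 2 :=
    pow_le_pow_left₀ (by positivity) hd 2
  have h6 : (A.card : ℝ) * (ε ^ 2 * A.card * P.card ^ 2) ≤
      A.card * ∑ a ∈ A, (∑ b ∈ P, w a b) ^ 2 := by nlinarith
  have h7 := le_of_mul_le_mul_left h6 hA'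
  nlinarith

lemma Q_zero {α : Type} {m : ℕ} (ι : α → Fin m → ℝ) (k : ℕ) : QStep ι k 0 := by
  intro ε hε
  refine ⟨ε, hε, ?_⟩
  intro φ ψ A X w hA w0 w1 hw _ hd
  exact ⟨A, X, subset_rfl, fun _ => subset_rfl, by simp, hd⟩


lemma sum_le_card {α β : Type} (A : Finset α) (P : Finset β) (w : α → β → ℝ)
    (w1 : ∀ a b, w a b ≤ 1) : ∑ a ∈ A, ∑ b ∈ P, w a b ≤ (A.card : ℝ) * P.card := by
  calc ∑ a ∈ A, ∑ b ∈ P, w a b ≤ ∑ a ∈ A, ∑ b ∈ P, (1 : ℝ) :=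
        Finset.sum_le_sum fun a _ => Finset.sum_le_sum fun b _ => w1 a b
    _ = _ := by simp

lemma card_pi_mono {α : Type} {k : ℕ} {X Y : Fin k → Finset α} (h : ∀ i, Y i ⊆ X i) :
    ((Fintype.piFinset Y).card : ℝ) ≤ (Fintype.piFinset X).card := by
  exact_mod_cast Finset.card_le_card (Fintype.piFinset_subset _ _ h)

lemma Q_case_zero {α : Type} {m : ℕ} {ι : α → Fin m → ℝ} {k D : ℕ} (hP : PStep ι k)
    (hQ : QStep ι k D) :
    QConcl ι k (D + 1) (fun ψ w => ∀ a b, w a b ≠ 0 → ψ 0 (fun i => ι (b i)) = 0) := by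
  intro ε hε
  obtain ⟨δ₁, hδ₁, H₁⟩ := hP.ext ε hε
  obtain ⟨δ₂, hδ₂, H₂⟩ := hP.ext δ₁ hδ₁
  obtain ⟨δ, hδ, H⟩ := hQ (δ₂ * δ₁) (by positivity)
  refine ⟨δ * (δ₂ * δ₁), by positivity, ?_⟩
  intro φ ψ A X w hA w0 w1 hw hS hd
  obtain ⟨X₁, hX₁, hf₁, hd₁⟩ := H₁ (ψ 0) A X w hA w0 w1 (fun a b h => (hS a b h).ge) hd
  have n₁ := card_pi_mono hX₁
  obtain ⟨X₂, hX₂, hf₂, hd₂⟩ := H₂ (-ψ 0) A X₁ w hA w0 w1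
    (fun a b h => by simp [hS a b h]) (le_trans (by gcongr) hd₁)
  have n₂ := card_pi_mono hX₂
  have m₁ := hd₁.trans (sum_le_card A _ w w1)
  have m₂ := hd₂.trans (sum_le_card A _ w w1)
  have key : (δ₂ * δ₁) * ((A.card : ℝ) * ((Fintype.piFinset X).card : ℝ)) ≤
      ∑ a ∈ A, ∑ b ∈ Fintype.piFinset X₂, w a b := by
    refine le_trans ?_ hd₂
    rw [mul_assoc]
    gcongr
  have m₃ := key.trans (sum_le_card A _ w w1)
  obtain ⟨A', Y, hA', hY, hf, hs⟩ := H (fun j => φ j.succ) (fun j => ψ j.succ) A X₂ w hA w0 w1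
    (fun a b h => by
      have := hw a b h
      rw [Fin.sum_univ_succ, hS a b h] at this
      simpa using this) trivial
    (le_trans (by have := n₂.trans n₁; gcongr ?_ * (?_ * ?_)) key)
  refine ⟨A', Y, hA', fun i => (hY i).trans ((hX₂ i).trans (hX₁ i)), ?_, ?_⟩
  · intro a ha b hb
    have hb2 := Fintype.piFinset_subset _ _ hY hb
    have hb1 := Fintype.piFinset_subset _ _ hX₂ hb2
    have h1 := hf₁ b hb1
    have h2 := hf₂ b hb2
    have h3 : ψ 0 (fun i => ι (b i)) = 0 := by
      simp only [MultilinearMap.neg_apply] at h2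
      linarith
    rw [Fin.sum_univ_succ, h3]
    simpa using hf a ha b hb
  · refine le_trans ?_ hs
    rw [mul_assoc]
    gcongr

lemma Q_case_pos {α : Type} {m : ℕ} {ι : α → Fin m → ℝ} {k D : ℕ} (hP : PStep ι k)
    (hQ : QStep ι k D) :
    QConcl ι k (D + 1) (fun ψ w => ∀ a b, w a b ≠ 0 → 0 < ψ 0 (fun i => ι (b i))) := by
  intro ε hε
  obtain ⟨δ₁, hδ₁, H₁⟩ := hP.ext (ε ^ 2 / 2) (by positivity)
  obtain ⟨δ, hδ, H⟩ := hQ δ₁ hδ₁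
  refine ⟨δ * δ₁, by positivity, ?_⟩
  intro φ ψ A X w hA w0 w1 hw hS hd
  rcases (Fintype.piFinset X).eq_empty_or_nonempty with he | hne
  · exact ⟨A, X, subset_rfl, fun _ => subset_rfl, by simp [he], by simp [he]⟩
  obtain ⟨b0, hb0, hd0⟩ := exists_pivot A (Fintype.piFinset X) w
    (fun a b => (∑ j : Fin D, φ j.succ a * ψ j.succ (fun i => ι (b i))) / ψ 0 (fun i => ι (b i)))
    w0 ε hε hA hne hd
  set h : α → (Fin k → α) → ℝ := fun a b =>
    (∑ j : Fin D, φ j.succ a * ψ j.succ (fun i => ι (b i))) / ψ 0 (fun i => ι (b i)) with hh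
  set ww : α → (Fin k → α) → ℝ := fun a b => if h a b0 ≤ h a b then w a b * w a b0 else 0 with hww
  have wwNonneg : ∀ a b, 0 ≤ ww a b := by
    intro a b
    simp only [hww]
    split_ifs
    · exact mul_nonneg (w0 _ _) (w0 _ _)
    · exact le_rfl
  have wwLe : ∀ a b, ww a b ≤ w a b := by
    intro a b
    simp only [hww]
    split_ifs
    · exact mul_le_of_le_one_right (w0 _ _) (w1 _ _)
    · exact w0 _ _
  have wwLeOne : ∀ a b, ww a b ≤ 1 := fun a b => (wwLe a b).trans (w1 a b)
  have wwSupp : ∀ a b, ww a b ≠ 0 → w a b ≠ 0 ∧ w a b0 ≠ 0 ∧ h a b0 ≤ h a b := by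
    intro a b hab
    simp only [hww] at hab
    split_ifs at hab with hc
    · exact ⟨left_ne_zero_of_mul hab, right_ne_zero_of_mul hab, hc⟩
    · exact absurd rfl hab
  obtain ⟨X₁, hX₁, hf₁, hd₁⟩ := H₁ (ψ 0) A X ww hA wwNonneg wwLeOne
    (fun a b hab => (hS a b (wwSupp a b hab).1).le) hd0
  have n₁ := card_pi_mono hX₁
  have m₁ := hd₁.trans (sum_le_card A _ ww wwLeOne)
  set p0 : ℝ := ψ 0 (fun i => ι (b0 i)) with hp0
  obtain ⟨A', Y, hA', hY, hf, hs⟩ := H (fun j => φ j.succ)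
    (fun j => ψ j.succ - (ψ j.succ (fun i => ι (b0 i)) / p0) • ψ 0) A X₁ ww hA wwNonneg wwLeOne
    (fun a b hab => by
      obtain ⟨q1, q2, q3⟩ := wwSupp a b hab
      have r1 := hS a b q1
      have r2 := hS a b0 q2
      have e : ∑ j : Fin D, φ j.succ a * (ψ j.succ - (ψ j.succ (fun i => ι (b0 i)) / p0) • ψ 0)
          (fun i => ι (b i)) = ψ 0 (fun i => ι (b i)) * (h a b - h a b0) := by
        simp only [hh, MultilinearMap.sub_apply, MultilinearMap.smul_apply, smul_eq_mul]
        rw [mul_sub, mul_div_cancel₀ _ r1.ne', Finset.sum_div, Finset.mul_sum,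
          ← Finset.sum_sub_distrib]
        refine Finset.sum_congr rfl fun j _ => ?_
        ring
      rw [e]
      exact mul_nonneg r1.le (sub_nonneg.2 q3)) trivial
    (le_trans (by gcongr) hd₁)
  refine ⟨A'.filter (fun a => w a b0 ≠ 0), Y, (Finset.filter_subset _ _).trans hA',
    fun i => (hY i).trans (hX₁ i), ?_, ?_⟩
  · intro a ha b hb
    obtain ⟨ha1, ha2⟩ := Finset.mem_filter.1 ha
    have r1 := hf₁ b (Fintype.piFinset_subset _ _ hY hb)
    have r2 : 0 < p0 := hS a b0 ha2
    have r3 := hf a ha1 b hb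
    have r4 := hw a b0 ha2
    have e : ∑ j, φ j a * ψ j (fun i => ι (b i)) =
        (∑ j : Fin D, φ j.succ a * (ψ j.succ - (ψ j.succ (fun i => ι (b0 i)) / p0) • ψ 0)
          (fun i => ι (b i))) +
        (∑ j, φ j a * ψ j (fun i => ι (b0 i))) / p0 * ψ 0 (fun i => ι (b i)) := by
      simp only [MultilinearMap.sub_apply, MultilinearMap.smul_apply, smul_eq_mul, mul_sub,
        Finset.sum_sub_distrib, Fin.sum_univ_succ (n := D)]
      rw [← hp0, add_div, mul_div_cancel_right₀ _ r2.ne', add_mul, Finset.sum_div, Finset.sum_mul]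
      have : ∀ j : Fin D, φ j.succ a * (ψ j.succ (fun i => ι (b0 i)) / p0 * ψ 0 (fun i => ι (b i)))
        = φ j.succ a * ψ j.succ (fun i => ι (b0 i)) / p0 * ψ 0 (fun i => ι (b i)) := by
        intro j; ring
      simp only [this]
      ring
    rw [e]
    exact add_nonneg r3 (mul_nonneg (div_nonneg r4 r2.le) r1)
  · have t1 : ∑ a ∈ A', ∑ b ∈ Fintype.piFinset Y, ww a b =
        ∑ a ∈ A'.filter (fun a => w a b0 ≠ 0), ∑ b ∈ Fintype.piFinset Y, ww a b := by
      rw [Finset.sum_filter]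
      refine Finset.sum_congr rfl fun a _ => ?_
      split_ifs with hc
      · rfl
      · refine Finset.sum_eq_zero fun b _ => ?_
        by_contra hx
        exact hc (wwSupp a b hx).2.1
    rw [t1] at hs
    calc δ * δ₁ * ((A.card : ℝ) * ((Fintype.piFinset X).card : ℝ))
        = δ * (δ₁ * ((A.card : ℝ) * ((Fintype.piFinset X).card : ℝ))) := by ring
      _ ≤ δ * ((A.card : ℝ) * ((Fintype.piFinset X₁).card : ℝ)) := by gcongr
      _ ≤ _ := hs
      _ ≤ _ := Finset.sum_le_sum fun a _ => Finset.sum_le_sum fun b _ => wwLe a b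

lemma Q_succ {α : Type} {m : ℕ} {ι : α → Fin m → ℝ} {k D : ℕ} (hP : PStep ι k)
    (hQ : QStep ι k D) : QStep ι k (D + 1) := by
  intro ε hε
  obtain ⟨δ₁, hδ₁, H₁⟩ := Q_case_zero hP hQ (ε / 3) (by positivity)
  obtain ⟨δ₂, hδ₂, H₂⟩ := Q_case_pos hP hQ (ε / 3) (by positivity)
  refine ⟨min δ₁ δ₂, lt_min hδ₁ hδ₂, ?_⟩
  intro φ ψ A X w hA w0 w1 hw _ hd
  have aux : ∀ (p : (Fin k → α) → Prop),
      (∀ a b, 0 ≤ if p b then w a b else 0) ∧ (∀ a b, (if p b then w a b else 0) ≤ 1) ∧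
      (∀ a b, (if p b then w a b else 0) ≤ w a b) ∧
      (∀ a b, (if p b then w a b else 0) ≠ 0 → p b ∧ w a b ≠ 0) := by
    intro p
    refine ⟨fun a b => ?_, fun a b => ?_, fun a b => ?_, fun a b => ?_⟩
    · split_ifs
      exacts [w0 a b, le_rfl]
    · split_ifs
      exacts [w1 a b, zero_le_one]
    · split_ifs
      exacts [le_rfl, w0 a b]
    · split_ifs with hc
      · exact fun h => ⟨hc, h⟩
      · exact fun h => absurd rfl h
  have split : ∑ a ∈ A, ∑ b ∈ Fintype.piFinset X, w a b =
      ∑ a ∈ A, ∑ b ∈ Fintype.piFinset X, (if ψ 0 (fun i => ι (b i)) = 0 then w a b else 0) +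
      ∑ a ∈ A, ∑ b ∈ Fintype.piFinset X, (if 0 < ψ 0 (fun i => ι (b i)) then w a b else 0) +
      ∑ a ∈ A, ∑ b ∈ Fintype.piFinset X, (if ψ 0 (fun i => ι (b i)) < 0 then w a b else 0) := by
    simp only [← Finset.sum_add_distrib]
    refine Finset.sum_congr rfl fun a _ => Finset.sum_congr rfl fun b _ => ?_
    rcases lt_trichotomy (ψ 0 (fun i => ι (b i))) 0 with hc | hc | hc
    · simp [hc, hc.ne, hc.le]
    · simp [hc]
    · simp [hc, hc.ne', hc.le]
  have N0 : (0 : ℝ) ≤ (A.card : ℝ) * ((Fintype.piFinset X).card : ℝ) := by positivity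
  have cases3 :
      ε / 3 * ((A.card : ℝ) * ((Fintype.piFinset X).card : ℝ)) ≤ ∑ a ∈ A,
        ∑ b ∈ Fintype.piFinset X, (if ψ 0 (fun i => ι (b i)) = 0 then w a b else 0) ∨
      ε / 3 * ((A.card : ℝ) * ((Fintype.piFinset X).card : ℝ)) ≤ ∑ a ∈ A,
        ∑ b ∈ Fintype.piFinset X, (if 0 < ψ 0 (fun i => ι (b i)) then w a b else 0) ∨
      ε / 3 * ((A.card : ℝ) * ((Fintype.piFinset X).card : ℝ)) ≤ ∑ a ∈ A,
        ∑ b ∈ Fintype.piFinset X, (if ψ 0 (fun i => ι (b i)) < 0 then w a b else 0) := by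
    by_contra! hc
    obtain ⟨c1, c2, c3⟩ := hc
    linarith
  rcases cases3 with hc | hc | hc
  · obtain ⟨v0, v1, vw, vs⟩ := aux (fun b => ψ 0 (fun i => ι (b i)) = 0)
    obtain ⟨A', Y, hA', hY, hf, hs⟩ := H₁ φ ψ A X _ hA v0 v1
      (fun a b h => hw a b (vs a b h).2) (fun a b h => (vs a b h).1) hc
    refine ⟨A', Y, hA', hY, hf, ?_⟩
    calc _ ≤ δ₁ * ((A.card : ℝ) * ((Fintype.piFinset X).card : ℝ)) := by
          gcongr; exact min_le_left _ _
      _ ≤ _ := hs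
      _ ≤ _ := Finset.sum_le_sum fun a _ => Finset.sum_le_sum fun b _ => vw a b
  · obtain ⟨v0, v1, vw, vs⟩ := aux (fun b => 0 < ψ 0 (fun i => ι (b i)))
    obtain ⟨A', Y, hA', hY, hf, hs⟩ := H₂ φ ψ A X _ hA v0 v1
      (fun a b h => hw a b (vs a b h).2) (fun a b h => (vs a b h).1) hc
    refine ⟨A', Y, hA', hY, hf, ?_⟩
    calc _ ≤ δ₂ * ((A.card : ℝ) * ((Fintype.piFinset X).card : ℝ)) := by
          gcongr; exact min_le_right _ _
      _ ≤ _ := hs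
      _ ≤ _ := Finset.sum_le_sum fun a _ => Finset.sum_le_sum fun b _ => vw a b
  · obtain ⟨v0, v1, vw, vs⟩ := aux (fun b => ψ 0 (fun i => ι (b i)) < 0)
    have e : ∀ a (b : Fin k → α), ∑ j, (-φ j) a * (-ψ j) (fun i => ι (b i)) =
        ∑ j, φ j a * ψ j (fun i => ι (b i)) := by
      intro a b
      simp
    obtain ⟨A', Y, hA', hY, hf, hs⟩ := H₂ (fun j => -φ j) (fun j => -ψ j) A X _ hA v0 v1
      (fun a b h => by rw [e]; exact hw a b (vs a b h).2)
      (fun a b h => by simpa using (vs a b h).1) hc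
    refine ⟨A', Y, hA', hY, fun a ha b hb => by rw [← e]; exact hf a ha b hb, ?_⟩
    calc _ ≤ δ₂ * ((A.card : ℝ) * ((Fintype.piFinset X).card : ℝ)) := by
          gcongr; exact min_le_right _ _
      _ ≤ _ := hs
      _ ≤ _ := Finset.sum_le_sum fun a _ => Finset.sum_le_sum fun b _ => vw a b

lemma Q_all {α : Type} {m : ℕ} {ι : α → Fin m → ℝ} {k : ℕ} (hP : PStep ι k) (D : ℕ) :
    QStep ι k D := by
  induction D with
  | zero => exact Q_zero ι k
  | succ D ih => exact Q_succ hP ih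

lemma sum_pi_succ {α : Type} {k : ℕ} (X : Fin (k + 1) → Finset α) (w : (Fin (k + 1) → α) → ℝ) :
    ∑ b ∈ Fintype.piFinset X, w b =
      ∑ a ∈ X 0, ∑ b ∈ Fintype.piFinset (Fin.tail X), w (Fin.cons a b) := by
  rw [← Finset.sum_product']
  refine Finset.sum_bij' (fun b _ => (b 0, Fin.tail b)) (fun p _ => Fin.cons p.1 p.2) ?_ ?_ ?_ ?_ ?_
  · intro b hb
    rw [Fintype.mem_piFinset] at hb
    simp only [Finset.mem_product, Fintype.mem_piFinset]
    exact ⟨hb 0, fun i => hb i.succ⟩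
  · rintro ⟨a, b⟩ h
    simp only [Finset.mem_product, Fintype.mem_piFinset] at h
    rw [Fintype.mem_piFinset]
    intro i
    refine Fin.cases ?_ (fun i => ?_) i
    · exact h.1
    · exact h.2 i
  · intro b _
    exact Fin.cons_self_tail b
  · rintro ⟨a, b⟩ _
    simp
  · intro b _
    rw [Fin.cons_self_tail]

lemma card_pi_succ {α : Type} {k : ℕ} (X : Fin (k + 1) → Finset α) :
    ((Fintype.piFinset X).card : ℝ) =
      ((X 0).card : ℝ) * ((Fintype.piFinset (Fin.tail X)).card : ℝ) := by
  have := sum_pi_succ X (fun _ => 1)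
  simpa using this

lemma P_zero {α : Type} {m : ℕ} (ι : α → Fin m → ℝ) : PStep ι 0 := by
  intro ε hε
  refine ⟨ε, hε, ?_⟩
  intro f X w w0 w1 hw hd
  refine ⟨X, fun _ => subset_rfl, ?_, hd⟩
  have hX : (Fintype.piFinset X) = {Fin.elim0} := by
    ext b
    simp only [Fintype.mem_piFinset, Finset.mem_singleton]
    exact ⟨fun _ => Subsingleton.elim _ _, fun _ i => i.elim0⟩
  rw [hX] at hd ⊢
  intro b hb
  apply hw
  rw [Finset.mem_singleton] at hb
  subst hb
  simp at hd
  exact (hε.trans_le hd).ne'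

lemma P_succ {α : Type} {m : ℕ} {ι : α → Fin m → ℝ} {k : ℕ} (hP : PStep ι k) :
    PStep ι (k + 1) := by
  intro ε hε
  obtain ⟨δ, hδ, H⟩ := Q_all hP m ε hε
  refine ⟨δ, hδ, ?_⟩
  intro f X w w0 w1 hw hd
  rcases (Fintype.piFinset X).eq_empty_or_nonempty with he | hne
  · exact ⟨X, fun _ => subset_rfl, by simp [he], by simp [he]⟩
  have hA : (X 0).Nonempty := by
    obtain ⟨b, hb⟩ := hne
    exact ⟨b 0, (Fintype.mem_piFinset.1 hb) 0⟩
  have e : ∀ a (b : Fin k → α),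
      ∑ j, ι a j * f.curryLeft (Pi.single j 1) (fun i => ι (b i)) =
        f (fun i => ι ((Fin.cons a b : Fin (k + 1) → α) i)) := by
    intro a b
    have h1 : ι a = ∑ j, ι a j • (Pi.single j 1 : Fin m → ℝ) := by
      ext i
      simp [Finset.sum_apply, Pi.single_apply]
    have h2 : (fun i => ι ((Fin.cons a b : Fin (k + 1) → α) i)) =
        (Fin.cons (ι a) (fun i => ι (b i)) : Fin (k + 1) → Fin m → ℝ) := by
      ext i
      refine Fin.cases ?_ (fun i => ?_) i <;> simp
    rw [h2]
    have h3 : f (Fin.cons (ι a) (fun i => ι (b i))) = f.curryLeft (ι a) (fun i => ι (b i)) := rfl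
    rw [h3]
    conv_rhs => rw [h1]
    rw [map_sum, MultilinearMap.sum_apply]
    refine Finset.sum_congr rfl fun j _ => ?_
    rw [map_smul, MultilinearMap.smul_apply, smul_eq_mul]
  rw [sum_pi_succ, card_pi_succ] at hd
  obtain ⟨A', Y, hA', hY, hf, hs⟩ := H (fun j a => ι a j) (fun j => f.curryLeft (Pi.single j 1))
    (X 0) (Fin.tail X) (fun a b => w (Fin.cons a b)) hA (fun a b => w0 _) (fun a b => w1 _)
    (fun a b h => by rw [e]; exact hw _ h) trivial hd
  refine ⟨Fin.cons A' Y, ?_, ?_, ?_⟩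
  · intro i
    refine Fin.cases ?_ (fun i => ?_) i
    · exact hA'
    · exact hY i
  · intro b hb
    rw [Fintype.mem_piFinset] at hb
    have := hf (b 0) (hb 0) (Fin.tail b) (Fintype.mem_piFinset.2 fun i => hb i.succ)
    rw [e, Fin.cons_self_tail] at this
    exact this
  · rw [sum_pi_succ, card_pi_succ]
    simpa using hs

lemma P_all {α : Type} {m : ℕ} (ι : α → Fin m → ℝ) (k : ℕ) : PStep ι k := by
  induction k with
  | zero => exact P_zero ι
  | succ k ih => exact P_succ ih

/-- Homogeneous subsets for a nowhere vanishing form. -/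
lemma homog {α : Type} {m : ℕ} (ι : α → Fin m → ℝ) (k : ℕ)
    (f : MultilinearMap ℝ (fun _ : Fin k => (Fin m → ℝ)) ℝ) :
    ∃ c : ℝ, 0 < c ∧ c ≤ 1 ∧ ∀ X : Fin k → Finset α,
      (∀ b ∈ Fintype.piFinset X, f (fun i => ι (b i)) ≠ 0) →
      ∃ Y : Fin k → Finset α, (∀ i, Y i ⊆ X i) ∧
        ((∀ b ∈ Fintype.piFinset Y, 0 < f (fun i => ι (b i))) ∨
          (∀ b ∈ Fintype.piFinset Y, f (fun i => ι (b i)) < 0)) ∧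
        ∀ i, c * ((X i).card : ℝ) ≤ ((Y i).card : ℝ) := by
  obtain ⟨δ, hδ, H⟩ := P_all ι k (1 / 2) (by norm_num)
  refine ⟨min δ 1, lt_min hδ one_pos, min_le_right _ _, ?_⟩
  intro X hX
  rcases (Fintype.piFinset X).eq_empty_or_nonempty with he | hne
  · refine ⟨X, fun _ => subset_rfl, Or.inl (by simp [he]), fun i => ?_⟩
    exact mul_le_of_le_one_left (by positivity) (min_le_right _ _)
  have hpos : ∀ i, (0 : ℝ) < (X i).card := by
    obtain ⟨b, hb⟩ := hne
    intro i
    exact_mod_cast Finset.card_pos.2 ⟨b i, (Fintype.mem_piFinset.1 hb) i⟩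
  have main : ∀ g : MultilinearMap ℝ (fun _ : Fin k => (Fin m → ℝ)) ℝ,
      (∀ b ∈ Fintype.piFinset X, g (fun i => ι (b i)) ≠ 0) →
      1 / 2 * ((Fintype.piFinset X).card : ℝ) ≤
        ∑ b ∈ Fintype.piFinset X, (if 0 < g (fun i => ι (b i)) then (1 : ℝ) else 0) →
      ∃ Y : Fin k → Finset α, (∀ i, Y i ⊆ X i) ∧
        (∀ b ∈ Fintype.piFinset Y, 0 < g (fun i => ι (b i))) ∧
        ∀ i, min δ 1 * ((X i).card : ℝ) ≤ ((Y i).card : ℝ) := by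
    intro g hg hd
    obtain ⟨Y, hY, hf, hs⟩ := H g X (fun b => if 0 < g (fun i => ι (b i)) then (1 : ℝ) else 0)
      (fun b => by split_ifs <;> norm_num) (fun b => by split_ifs <;> norm_num)
      (fun b h => by
        split_ifs at h with hc
        · exact hc.le
        · exact absurd rfl h) hd
    refine ⟨Y, hY, fun b hb => lt_of_le_of_ne (hf b hb)
      (hg b (Fintype.piFinset_subset _ _ hY hb)).symm, fun i => ?_⟩
    have h1 : δ * ((Fintype.piFinset X).card : ℝ) ≤ (Fintype.piFinset Y).card := by
      refine hs.trans ?_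
      calc _ ≤ ∑ b ∈ Fintype.piFinset Y, (1 : ℝ) :=
            Finset.sum_le_sum fun b _ => by split_ifs <;> norm_num
        _ = _ := by simp
    rw [Fintype.card_piFinset, Fintype.card_piFinset] at h1
    push_cast at h1
    rw [← Finset.mul_prod_erase _ _ (Finset.mem_univ i),
      ← Finset.mul_prod_erase _ (fun j => ((Y j).card : ℝ)) (Finset.mem_univ i)] at h1
    have h2 : ∏ j ∈ Finset.univ.erase i, ((Y j).card : ℝ) ≤
        ∏ j ∈ Finset.univ.erase i, ((X j).card : ℝ) :=
      Finset.prod_le_prod (fun _ _ => by positivity)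
        (fun j _ => by exact_mod_cast Finset.card_le_card (hY j))
    have h3 : 0 < ∏ j ∈ Finset.univ.erase i, ((X j).card : ℝ) :=
      Finset.prod_pos fun j _ => hpos j
    have h4 : (δ * ((X i).card : ℝ)) * ∏ j ∈ Finset.univ.erase i, ((X j).card : ℝ) ≤
        ((Y i).card : ℝ) * ∏ j ∈ Finset.univ.erase i, ((X j).card : ℝ) := by
      rw [mul_assoc]
      refine h1.trans ?_
      gcongr
    refine le_trans ?_ (le_of_mul_le_mul_right h4 h3)
    gcongr
    exact min_le_left _ _
  have split : ((Fintype.piFinset X).card : ℝ) =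
      ∑ b ∈ Fintype.piFinset X, (if 0 < f (fun i => ι (b i)) then (1 : ℝ) else 0) +
      ∑ b ∈ Fintype.piFinset X, (if 0 < (-f) (fun i => ι (b i)) then (1 : ℝ) else 0) := by
    rw [← Finset.sum_add_distrib, Finset.card_eq_sum_ones]
    push_cast
    refine Finset.sum_congr rfl fun b hb => ?_
    rcases lt_or_gt_of_ne (hX b hb) with hc | hc
    · simp [hc, hc.le]
    · simp [hc, hc.le]
  rcases le_total (1 / 2 * ((Fintype.piFinset X).card : ℝ))
    (∑ b ∈ Fintype.piFinset X, (if 0 < f (fun i => ι (b i)) then (1 : ℝ) else 0)) with hc | hc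
  · obtain ⟨Y, h1, h2, h3⟩ := main f hX hc
    exact ⟨Y, h1, Or.inl h2, h3⟩
  · obtain ⟨Y, h1, h2, h3⟩ := main (-f) (fun b hb => by simpa using hX b hb) (by linarith)
    exact ⟨Y, h1, Or.inr fun b hb => by simpa using h2 b hb, h3⟩

/-- The determinant defining the orientation. -/
noncomputable def orientDet (d : ℕ) (p : Fin (d + 1) → (Fin d → ℝ)) : ℝ :=
  Matrix.det (Matrix.of fun i j => Fin.cases (motive := fun _ => ℝ) 1 (fun i' => p j i') i)

lemma orientDet_eq (d : ℕ) (p : Fin (d + 1) → (Fin d → ℝ)) :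
    (Matrix.detRowAlternating (R := ℝ) (n := Fin (d + 1))).toMultilinearMap
      (fun i => (Fin.cons 1 (p i) : Fin (d + 1) → ℝ)) = orientDet d p := by
  unfold orientDet
  rw [← Matrix.det_transpose]
  rfl

lemma orientDet_ne_zero (d : ℕ) (p : Fin (d + 1) → (Fin d → ℝ)) (hp : AffineIndependent ℝ p) :
    orientDet d p ≠ 0 := by
  intro h
  obtain ⟨v, hv, hM⟩ := Matrix.exists_mulVec_eq_zero_iff.2 h
  apply hv
  rw [affineIndependent_iff] at hp
  ext i
  refine hp Finset.univ v ?_ ?_ i (Finset.mem_univ i)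
  · have := congrFun hM 0
    simpa [Matrix.mulVec, dotProduct] using this
  · ext i'
    have := congrFun hM i'.succ
    simp [Matrix.mulVec, dotProduct] at this
    simpa [Finset.sum_apply, mul_comm] using this

lemma tuple_step (d : ℕ) : ∃ c : ℝ, 0 < c ∧ c ≤ 1 ∧ ∀ X : Fin (d + 1) → Finset (Fin d → ℝ),
      (∀ b, (∀ i, b i ∈ X i) → orientDet d b ≠ 0) →
      ∃ Y : Fin (d + 1) → Finset (Fin d → ℝ), (∀ i, Y i ⊆ X i) ∧ SameTypeTuple d Y ∧
        ∀ i, c * ((X i).card : ℝ) ≤ ((Y i).card : ℝ) := by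
  obtain ⟨c, c0, c1, H⟩ := homog (α := Fin d → ℝ) (m := d + 1) (fun p => Fin.cons 1 p) (d + 1)
    (Matrix.detRowAlternating (R := ℝ) (n := Fin (d + 1))).toMultilinearMap
  refine ⟨c, c0, c1, fun X hX => ?_⟩
  obtain ⟨Y, h1, h2, h3⟩ := H X (fun b hb => by
    rw [orientDet_eq]
    exact hX b (Fintype.mem_piFinset.1 hb))
  refine ⟨Y, h1, ?_, h3⟩
  rcases h2 with h2 | h2
  · refine ⟨1, one_ne_zero, fun y hy => ?_⟩
    have := h2 y (Fintype.mem_piFinset.2 hy)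
    rw [orientDet_eq] at this
    exact Real.sign_of_pos this
  · refine ⟨-1, by norm_num, fun y hy => ?_⟩
    have := h2 y (Fintype.mem_piFinset.2 hy)
    rw [orientDet_eq] at this
    exact Real.sign_of_neg this

lemma SameTypeTuple.mono {d : ℕ} {Y Z : Fin (d + 1) → Finset (Fin d → ℝ)}
    (h : SameTypeTuple d Y) (hZ : ∀ i, Z i ⊆ Y i) : SameTypeTuple d Z := by
  obtain ⟨o, ho, H⟩ := h
  exact ⟨o, ho, fun y hy => H y fun i => hZ i (hy i)⟩

lemma iterate_step (d r : ℕ) (S : Finset (Fin (d + 1) → Fin r)) :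
    ∃ c : ℝ, 0 < c ∧ ∀ X : Fin r → Finset (Fin d → ℝ),
      (∀ σ : Fin (d + 1) → Fin r, Function.Injective σ →
        ∀ b : Fin (d + 1) → Fin d → ℝ, (∀ i, b i ∈ X (σ i)) → orientDet d b ≠ 0) →
      ∃ Y : Fin r → Finset (Fin d → ℝ), (∀ i, Y i ⊆ X i) ∧
        (∀ σ ∈ S, Function.Injective σ → SameTypeTuple d (Y ∘ σ)) ∧
        ∀ i, c * ((X i).card : ℝ) ≤ ((Y i).card : ℝ) := by
  induction S using Finset.induction_on with
  | empty => exact ⟨1, one_pos, fun X _ => ⟨X, fun _ => subset_rfl, by simp, by simp⟩⟩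
  | insert τ S _ ih =>
    obtain ⟨c, c0, H⟩ := ih
    obtain ⟨cc, ccpos, ccle, H'⟩ := tuple_step d
    refine ⟨cc * c, by positivity, fun X hX => ?_⟩
    obtain ⟨Y, hY, hS, hc⟩ := H X hX
    by_cases hτ : Function.Injective τ
    · obtain ⟨Z, hZ, hT, hc'⟩ := H' (Y ∘ τ) (fun b hb => hX τ hτ b fun i => hY _ (hb i))
      have hsub : ∀ i, Function.extend τ Z Y i ⊆ Y i := by
        intro i
        by_cases hi : ∃ j, τ j = i
        · obtain ⟨j, rfl⟩ := hi
          rw [hτ.extend_apply]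
          exact hZ j
        · rw [Function.extend_apply' _ _ _ hi]
      refine ⟨Function.extend τ Z Y, fun i => (hsub i).trans (hY i), ?_, ?_⟩
      · intro σ hσ hinj
        rcases Finset.mem_insert.1 hσ with rfl | hσ
        · rwa [Function.extend_comp hinj]
        · exact (hS σ hσ hinj).mono fun i => hsub (σ i)
      · intro i
        have h1 : cc * ((Y i).card : ℝ) ≤ ((Function.extend τ Z Y i).card : ℝ) := by
          by_cases hi : ∃ j, τ j = i
          · obtain ⟨j, rfl⟩ := hi
            rw [hτ.extend_apply]
            exact hc' j
          · rw [Function.extend_apply' _ _ _ hi]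
            exact mul_le_of_le_one_left (by positivity) ccle
        refine le_trans ?_ h1
        rw [mul_assoc]
        exact mul_le_mul_of_nonneg_left (hc i) ccpos.le
    · refine ⟨Y, hY, ?_, fun i => ?_⟩
      · intro σ hσ hinj
        rcases Finset.mem_insert.1 hσ with rfl | hσ
        · exact absurd hinj hτ
        · exact hS σ hσ hinj
      · refine le_trans ?_ (hc i)
        rw [mul_assoc]
        exact mul_le_of_le_one_left (by positivity) ccle

/-- Same-Type Lemma: for all integers `d ≥ 2` and `r ≥ d + 1`, there exists a
constant `c = c(d,r) > 0` such that for all pairwise disjoint finite sets `X₁, …, X_r` in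
`ℝ^d` whose union is in general position, there exist subsets `Yᵢ ⊆ Xᵢ` having the same-type
property with `|Yᵢ| ≥ c·|Xᵢ|` for every `i`. -/
theorem stmt9 :
    ∀ d r : ℕ, 2 ≤ d → d + 1 ≤ r →
      ∃ c : ℝ, 0 < c ∧ ∀ X : Fin r → Finset (Fin d → ℝ),
        (∀ i j, i ≠ j → Disjoint (X i) (X j)) →
        GenPosD d {p | ∃ i, p ∈ X i} →
        ∃ Y : Fin r → Finset (Fin d → ℝ),
          (∀ i, Y i ⊆ X i) ∧ SameTypeProp d r Y ∧
          ∀ i, c * ((X i).card : ℝ) ≤ ((Y i).card : ℝ) := by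
  intro d r _ _
  obtain ⟨c, c0, H⟩ := iterate_step d r Finset.univ
  refine ⟨c, c0, fun X hdis hgen => ?_⟩
  obtain ⟨Y, h1, h2, h3⟩ := H X (by
    intro σ hσ b hb
    refine orientDet_ne_zero d b (hgen b ?_ fun i => ⟨σ i, hb i⟩)
    intro i j hij
    by_contra hne
    have := Finset.disjoint_left.1 (hdis (σ i) (σ j) fun h => hne (hσ h)) (hb i)
    exact this (hij ▸ hb j))
  exact ⟨Y, h1, fun σ hσ => h2 σ (Finset.mem_univ σ) hσ, h3⟩
end
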